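/- arXiv:0909.0210 — 2 statements merged into one kernel-verified Lean document; each statement's English description precedes it below -/
import Mathlib

section
/- Let α ∈ ℝ, ε > 0, x ∈ X_α, and 𝐣 ∈ Σ with Π(𝐣) = x. Then there exists K ∈ ℕ such that for every k ≥ K with V_k(𝐣) ≤ εk/2, there exists 𝐢 ∈ Σ satisfying: the distance from x to R_k(𝐢) is at most D₁ m^{−k}/2, R_k(𝐢) ∈ Y(α,ε,k), and row(i_r) = row(j_r) for all 1 ≤ r ≤ k. -/
open MeasureTheory Metric Real Set Filter
open scoped ENNReal Topology

noncomputable section BedfordMcMullen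

/-- `σ = log m / log n`. -/
def sig (m n : ℕ) : ℝ := Real.log m / Real.log n

/-- `l(k) = ⌊σ k⌋`. -/
def lk (m n k : ℕ) : ℕ := ⌊sig m n * k⌋₊

/-- The affine contraction `T_{i,j}(x,y) = ((x+j)/n, (y+i)/m)` for the digit `d = (i,j)`. -/
def Tmap (m n : ℕ) (d : ℕ × ℕ) (x : ℝ × ℝ) : ℝ × ℝ :=
  ((x.1 + d.2) / n, (x.2 + d.1) / m)

/-- `Λ` is the Bedford–McMullen carpet: the unique nonempty compact set with
`Λ = ⋃_{d ∈ D} T_d(Λ)`. -/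
def IsAttractor (m n : ℕ) (D : Finset (ℕ × ℕ)) (Λ : Set (ℝ × ℝ)) : Prop :=
  IsCompact Λ ∧ Λ.Nonempty ∧ Λ = ⋃ d ∈ D, Tmap m n d '' Λ

/-- `μ` is the self-affine (Bernoulli) measure with weights `p`. -/
def IsSelfAffine (m n : ℕ) (D : Finset (ℕ × ℕ)) (p : ℕ × ℕ → ℝ)
    (μ : Measure (ℝ × ℝ)) : Prop :=
  ∀ A : Set (ℝ × ℝ), MeasurableSet A →
    μ A = ∑ d ∈ D, ENNReal.ofReal (p d) * μ (Tmap m n d ⁻¹' A)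

/-- `q_i = Σ_{j : (i,j) ∈ D} p_{ij}`. -/
def qrow (D : Finset (ℕ × ℕ)) (p : ℕ × ℕ → ℝ) (i : ℕ) : ℝ :=
  ∑ d ∈ D.filter fun d => d.1 = i, p d

/-- `γ_i(t) = Σ_{j : (i,j) ∈ D} p_{ij}^t`. -/
def gam (D : Finset (ℕ × ℕ)) (p : ℕ × ℕ → ℝ) (t : ℝ) (i : ℕ) : ℝ :=
  ∑ d ∈ D.filter fun d => d.1 = i, p d ^ t

/-- `β` satisfies, for every `t`, the defining equation
`m^{β(t)} Σ_{(i,j)∈D} p_{ij}^t q_i^{(1-σ)t} γ_i^{σ-1} = 1`. -/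
def IsBeta (m n : ℕ) (D : Finset (ℕ × ℕ)) (p : ℕ × ℕ → ℝ) (β : ℝ → ℝ) : Prop :=
  ∀ t : ℝ, (m : ℝ) ^ β t *
      ∑ d ∈ D, p d ^ t * qrow D p d.1 ^ ((1 - sig m n) * t) * gam D p t d.1 ^ (sig m n - 1) = 1

/-- The local dimension of `μ` at `x` exists and equals `α`. -/
def HasLocalDim (μ : Measure (ℝ × ℝ)) (x : ℝ × ℝ) (α : ℝ) : Prop :=
  Tendsto (fun r : ℝ => Real.log (μ (ball x r)).toReal / Real.log r) (𝓝[>] 0) (𝓝 α)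

/-- `X_α = {x ∈ Λ : d_μ(x) = α}`. -/
def levelSet (μ : Measure (ℝ × ℝ)) (Λ : Set (ℝ × ℝ)) (α : ℝ) : Set (ℝ × ℝ) :=
  {x | x ∈ Λ ∧ HasLocalDim μ x α}

/-- `α_min = min_{(i,j)∈D} (−σ log p_{ij} + (σ−1) log q_i)/log m`. -/
def alphaMin (m : ℕ) (D : Finset (ℕ × ℕ)) (p : ℕ × ℕ → ℝ) (σ : ℝ) : ℝ :=
  sInf ((fun d => (-σ * Real.log (p d) + (σ - 1) * Real.log (qrow D p d.1)) / Real.log m) ''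
    (D : Set (ℕ × ℕ)))

/-- `α_max = max_{(i,j)∈D} (−σ log p_{ij} + (σ−1) log q_i)/log m`. -/
def alphaMax (m : ℕ) (D : Finset (ℕ × ℕ)) (p : ℕ × ℕ → ℝ) (σ : ℝ) : ℝ :=
  sSup ((fun d => (-σ * Real.log (p d) + (σ - 1) * Real.log (qrow D p d.1)) / Real.log m) ''
    (D : Set (ℕ × ℕ)))

/-- A digit of `D`. -/
abbrev Digit (D : Finset (ℕ × ℕ)) := {d : ℕ × ℕ // d ∈ D}

/-- The symbol space `Σ = D^ℕ` (indexed from `0`; position `r` of the paper is index `r-1`). -/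
abbrev Word (D : Finset (ℕ × ℕ)) := ℕ → Digit D

/-- The natural projection `Π : Σ → ℝ²`. -/
def proj (m n : ℕ) {D : Finset (ℕ × ℕ)} (i : Word D) : ℝ × ℝ :=
  (∑' k : ℕ, ((i k).1.2 : ℝ) * (n : ℝ) ^ (-(k + 1 : ℤ)),
   ∑' k : ℕ, ((i k).1.1 : ℝ) * (m : ℝ) ^ (-(k + 1 : ℤ)))

/-- The approximate square `R_k(𝐢)`. -/
def approxSq (m n : ℕ) {D : Finset (ℕ × ℕ)} (k : ℕ) (i : Word D) : Set (ℝ × ℝ) :=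
  Icc (∑ r ∈ Finset.range (lk m n k), ((i r).1.2 : ℝ) * (n : ℝ) ^ (-(r + 1 : ℤ)))
      (∑ r ∈ Finset.range (lk m n k), ((i r).1.2 : ℝ) * (n : ℝ) ^ (-(r + 1 : ℤ)) +
        (n : ℝ) ^ (-(lk m n k : ℤ))) ×ˢ
  Icc (∑ r ∈ Finset.range k, ((i r).1.1 : ℝ) * (m : ℝ) ^ (-(r + 1 : ℤ)))
      (∑ r ∈ Finset.range k, ((i r).1.1 : ℝ) * (m : ℝ) ^ (-(r + 1 : ℤ)) + (m : ℝ) ^ (-(k : ℤ)))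

/-- `D₁ = √(n² + 1)`. -/
def D1 (n : ℕ) : ℝ := Real.sqrt ((n : ℝ) ^ 2 + 1)

/-- The symbolic local dimension of `μ` along `𝐢` exists and equals `α`. -/
def HasSymbDim (m n : ℕ) {D : Finset (ℕ × ℕ)} (μ : Measure (ℝ × ℝ)) (i : Word D)
    (α : ℝ) : Prop :=
  Tendsto (fun k : ℕ => -Real.log (μ (approxSq m n k i)).toReal / ((k : ℝ) * Real.log m))
    atTop (𝓝 α)

/-- `R_k(𝐢) ∈ Y(α, ε, k)`, i.e. `m^{-kα(1+ε)} ≤ μ(R_k(𝐢)) ≤ m^{-kα(1-ε)}`. -/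
def MemY (m n : ℕ) {D : Finset (ℕ × ℕ)} (μ : Measure (ℝ × ℝ)) (α ε : ℝ) (k : ℕ)
    (i : Word D) : Prop :=
  ENNReal.ofReal ((m : ℝ) ^ (-((k : ℝ) * α * (1 + ε)))) ≤ μ (approxSq m n k i) ∧
    μ (approxSq m n k i) ≤ ENNReal.ofReal ((m : ℝ) ^ (-((k : ℝ) * α * (1 - ε))))

/-- `P_{ij} = p_{ij}^t m^{β(t)} q_i^{(1−σ)t} γ_i^{σ−1}`. -/
def Pweight (m n : ℕ) (D : Finset (ℕ × ℕ)) (p : ℕ × ℕ → ℝ) (β : ℝ → ℝ) (t : ℝ)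
    (d : ℕ × ℕ) : ℝ :=
  p d ^ t * (m : ℝ) ^ β t * qrow D p d.1 ^ ((1 - sig m n) * t) * gam D p t d.1 ^ (sig m n - 1)

/-- `Q_i = Σ_{j : (i,j) ∈ D} P_{ij}`. -/
def Qrow (m n : ℕ) (D : Finset (ℕ × ℕ)) (p : ℕ × ℕ → ℝ) (β : ℝ → ℝ) (t : ℝ) (i : ℕ) : ℝ :=
  ∑ d ∈ D.filter fun d => d.1 = i, Pweight m n D p β t d

/-- `α(t) = (−σ Σ P_{ij} log p_{ij} − (1−σ) Σ Q_i log q_i)/log m`. -/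
def alphaT (m n : ℕ) (D : Finset (ℕ × ℕ)) (p : ℕ × ℕ → ℝ) (β : ℝ → ℝ) (t : ℝ) : ℝ :=
  (-(sig m n) * ∑ d ∈ D, Pweight m n D p β t d * Real.log (p d) -
      (1 - sig m n) * ∑ i ∈ Finset.range m, Qrow m n D p β t i * Real.log (qrow D p i)) /
    Real.log m

/-- `ν` is the Bernoulli (i.i.d. product) measure on `Σ = D^ℕ` with weights `P`. -/
def IsBernoulli {D : Finset (ℕ × ℕ)} (P : ℕ × ℕ → ℝ) (ν : Measure (Word D)) : Prop :=
  ∀ (k : ℕ) (w : Word D),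
    ν {i : Word D | ∀ r < k, i r = w r} = ∏ r ∈ Finset.range k, ENNReal.ofReal (P (w r).1)

/-- `Z_k(𝐢)` (with the convention `inf ∅ = ∞`). -/
def Zk (m n : ℕ) {D : Finset (ℕ × ℕ)} (i : Word D) (k : ℕ) : ℝ≥0∞ :=
  max (⨅ η ∈ {η : ℕ | 1 ≤ η ∧ (i (k + η - 1)).1.1 ≠ (i k).1.1}, (η : ℝ≥0∞))
    (ENNReal.ofReal (sig m n)⁻¹ *
      ⨅ η ∈ {η : ℕ | 1 ≤ η ∧ (i (lk m n k + η - 1)).1.2 ≠ (i (lk m n k)).1.2}, (η : ℝ≥0∞))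

/-- `V_k(𝐢) = inf{l > k : row(i_l) ∉ {0, m−1} or row(i_l) ≠ row(i_{k+1})} − k − 1`. -/
def Vk (m : ℕ) {D : Finset (ℕ × ℕ)} (i : Word D) (k : ℕ) : ℝ≥0∞ :=
  (⨅ l ∈ {l : ℕ | k < l ∧
      ((i (l - 1)).1.1 ∉ ({0, m - 1} : Set ℕ) ∨ (i (l - 1)).1.1 ≠ (i k).1.1)}, (l : ℝ≥0∞)) -
    ((k : ℝ≥0∞) + 1)

/-- `ω(i,j) = q_i^t γ_i^{−1}`. -/
def omg (D : Finset (ℕ × ℕ)) (p : ℕ × ℕ → ℝ) (t : ℝ) (d : ℕ × ℕ) : ℝ :=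
  qrow D p d.1 ^ t * (gam D p t d.1)⁻¹

/-- `B_l(𝐢) = (1/l) Σ_{r=1}^l log ω(i_r)`. -/
def Bl {D : Finset (ℕ × ℕ)} (p : ℕ × ℕ → ℝ) (t : ℝ) (i : Word D) (l : ℕ) : ℝ :=
  (1 / (l : ℝ)) * ∑ r ∈ Finset.range l, Real.log (omg D p t (i r).1)

/-- `A_k(𝐢) = B_{l(k)}(𝐢) − B_k(𝐢)`. -/
def Ak (m n : ℕ) {D : Finset (ℕ × ℕ)} (p : ℕ × ℕ → ℝ) (t : ℝ) (i : Word D) (k : ℕ) : ℝ :=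
  Bl p t i (lk m n k) - Bl p t i k

/-- `R_k(𝐢) ∈ G(α, ε, k) = Y(α,ε,k) ∩ {A_k ≥ −log(1+ε)}`. -/
def MemG (m n : ℕ) {D : Finset (ℕ × ℕ)} (μ : Measure (ℝ × ℝ)) (p : ℕ × ℕ → ℝ)
    (t α ε : ℝ) (k : ℕ) (i : Word D) : Prop :=
  MemY m n μ α ε k i ∧ -Real.log (1 + ε) ≤ Ak m n p t i k

open Classical in
/-- `Γ_k(𝐢)`: words of length `k` agreeing with `𝐢` on the first `l(k)` digits and with the
rows of `𝐢` on the remaining digits. -/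
def GammaSet (m n : ℕ) {D : Finset (ℕ × ℕ)} (k : ℕ) (i : Word D) :
    Finset (Fin k → Digit D) :=
  Finset.univ.filter fun w =>
    (∀ r : Fin k, (r : ℕ) < lk m n k → w r = i r) ∧
      ∀ r : Fin k, lk m n k ≤ (r : ℕ) → (w r).1.1 = (i (r : ℕ)).1.1

/-- `R̂_k(𝐢)`: the rectangle with the same center as `R_k(𝐢)` whose sides are `2D₁` times
longer. -/
def hatRect (m n : ℕ) {D : Finset (ℕ × ℕ)} (k : ℕ) (i : Word D) : Set (ℝ × ℝ) :=
  Icc (∑ r ∈ Finset.range (lk m n k), ((i r).1.2 : ℝ) * (n : ℝ) ^ (-(r + 1 : ℤ)) +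
        (n : ℝ) ^ (-(lk m n k : ℤ)) / 2 - D1 n * (n : ℝ) ^ (-(lk m n k : ℤ)))
      (∑ r ∈ Finset.range (lk m n k), ((i r).1.2 : ℝ) * (n : ℝ) ^ (-(r + 1 : ℤ)) +
        (n : ℝ) ^ (-(lk m n k : ℤ)) / 2 + D1 n * (n : ℝ) ^ (-(lk m n k : ℤ))) ×ˢ
  Icc (∑ r ∈ Finset.range k, ((i r).1.1 : ℝ) * (m : ℝ) ^ (-(r + 1 : ℤ)) +
        (m : ℝ) ^ (-(k : ℤ)) / 2 - D1 n * (m : ℝ) ^ (-(k : ℤ)))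
      (∑ r ∈ Finset.range k, ((i r).1.1 : ℝ) * (m : ℝ) ^ (-(r + 1 : ℤ)) +
        (m : ℝ) ^ (-(k : ℤ)) / 2 + D1 n * (m : ℝ) ^ (-(k : ℤ)))

/-! ### Base `b` expansions -/

def SS (b : ℕ) (a : ℕ → ℕ) (L : ℕ) : ℝ :=
  ∑ r ∈ Finset.range L, (a r : ℝ) * (b : ℝ) ^ (-(r + 1 : ℤ))

def NN (b : ℕ) (a : ℕ → ℕ) : ℕ → ℕ
  | 0 => 0
  | L + 1 => b * NN b a L + a L

lemma zpow_neg_succ_aux (b : ℕ) (hb : 2 ≤ b) (r : ℕ) :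
    (b : ℝ) ^ (-(r : ℤ)) = b * (b : ℝ) ^ (-(r + 1 : ℤ)) := by
  have hb0 : (b : ℝ) ≠ 0 := by positivity
  rw [← zpow_one_add₀ hb0]
  congr 1; ring

lemma SS_succ (b : ℕ) (a : ℕ → ℕ) (L : ℕ) :
    SS b a (L + 1) = SS b a L + (a L : ℝ) * (b : ℝ) ^ (-(L + 1 : ℤ)) := by
  simp [SS, Finset.sum_range_succ]

lemma SS_eq (b : ℕ) (hb : 2 ≤ b) (a : ℕ → ℕ) (L : ℕ) :
    SS b a L = NN b a L * (b : ℝ) ^ (-(L : ℤ)) := by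
  induction L with
  | zero => simp [SS, NN]
  | succ L ih =>
    rw [SS_succ, ih, NN, zpow_neg_succ_aux b hb L]
    push_cast
    ring

lemma NN_inj (b : ℕ) (a a' : ℕ → ℕ) (ha : ∀ r, a r < b) (ha' : ∀ r, a' r < b) (L : ℕ)
    (h : NN b a L = NN b a' L) : ∀ r < L, a r = a' r := by
  induction L with
  | zero => intro r hr; omega
  | succ L ih =>
    simp only [NN] at h
    have hb : 0 < b := lt_of_le_of_lt (Nat.zero_le _) (ha 0)
    have h1 := congrArg (· % b) h
    have h2 := congrArg (· / b) h
    simp only [Nat.mul_add_mod, Nat.mod_eq_of_lt (ha L), Nat.mod_eq_of_lt (ha' L)] at h1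
    simp only [Nat.mul_add_div hb, Nat.div_eq_of_lt (ha L), Nat.div_eq_of_lt (ha' L)] at h2
    intro r hr
    rcases Nat.lt_succ_iff_lt_or_eq.1 hr with hr | rfl
    · exact ih (by simpa using h2) r hr
    · exact h1

lemma SS_shift (b : ℕ) (hb : 2 ≤ b) (a : ℕ → ℕ) (L : ℕ) :
    SS b a (L + 1) = (SS b (fun r => a (r + 1)) L + a 0) / b := by
  have hb0 : (b : ℝ) ≠ 0 := by positivity
  rw [eq_div_iff hb0, SS, Finset.sum_range_succ', add_mul, SS, Finset.sum_mul]
  congr 1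
  · apply Finset.sum_congr rfl
    intro r _
    have := zpow_neg_succ_aux b hb (r + 1)
    push_cast at this ⊢
    have h2 : (-((r : ℤ) + 1)) = -1 + -(r : ℤ) := by ring
    rw [this]; ring
  · have := zpow_neg_succ_aux b hb 0
    simp at this ⊢
    field_simp

lemma SS_mono (b : ℕ) (a : ℕ → ℕ) : Monotone (SS b a) := by
  apply monotone_nat_of_le_succ
  intro L
  rw [SS_succ]
  have : 0 ≤ (a L : ℝ) * (b : ℝ) ^ (-(L + 1 : ℤ)) := by positivity
  linarith

def UU (b : ℕ) (a : ℕ → ℕ) (L : ℕ) : ℝ := SS b a L + (b : ℝ) ^ (-(L : ℤ))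

lemma UU_succ (b : ℕ) (hb : 2 ≤ b) (a : ℕ → ℕ) (L : ℕ) :
    UU b a (L + 1) = UU b a L - ((b : ℝ) - 1 - a L) * (b : ℝ) ^ (-(L + 1 : ℤ)) := by
  rw [UU, UU, SS_succ, zpow_neg_succ_aux b hb L]
  push_cast
  ring

lemma UU_anti (b : ℕ) (hb : 2 ≤ b) (a : ℕ → ℕ) (ha : ∀ r, a r < b) : Antitone (UU b a) := by
  apply antitone_nat_of_succ_le
  intro L
  rw [UU_succ b hb]
  have h1 : (a L : ℝ) + 1 ≤ b := by exact_mod_cast ha L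
  have : 0 ≤ ((b : ℝ) - 1 - a L) * (b : ℝ) ^ (-(L + 1 : ℤ)) :=
    mul_nonneg (by linarith) (by positivity)
  linarith

lemma zpow_anti_aux (b : ℕ) (hb : 2 ≤ b) {r l : ℕ} (h : r ≤ l) :
    (b : ℝ) ^ (-(l : ℤ)) ≤ (b : ℝ) ^ (-(r : ℤ)) := by
  apply zpow_le_zpow_right₀
  · exact_mod_cast (by omega : 1 ≤ b)
  · omega

lemma SS_summable (b : ℕ) (hb : 2 ≤ b) (a : ℕ → ℕ) (ha : ∀ r, a r < b) :
    Summable (fun r : ℕ => (a r : ℝ) * (b : ℝ) ^ (-(r + 1 : ℤ))) := by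
  apply summable_of_sum_range_le (c := UU b a 0)
  · intro r; positivity
  · intro N
    have h1 := UU_anti b hb a ha (Nat.zero_le N)
    have h2 : (0 : ℝ) ≤ (b : ℝ) ^ (-(N : ℤ)) := by positivity
    have h3 : UU b a N = SS b a N + (b : ℝ) ^ (-(N : ℤ)) := rfl
    change SS b a N ≤ _
    linarith

lemma SS_le_tsum (b : ℕ) (hb : 2 ≤ b) (a : ℕ → ℕ) (ha : ∀ r, a r < b) (L : ℕ) :
    SS b a L ≤ ∑' r : ℕ, (a r : ℝ) * (b : ℝ) ^ (-(r + 1 : ℤ)) :=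
  (SS_summable b hb a ha).sum_le_tsum _ (fun r _ => by positivity)

lemma tsum_le_UU (b : ℕ) (hb : 2 ≤ b) (a : ℕ → ℕ) (ha : ∀ r, a r < b) (L : ℕ) :
    ∑' r : ℕ, (a r : ℝ) * (b : ℝ) ^ (-(r + 1 : ℤ)) ≤ UU b a L := by
  apply le_of_tendsto (SS_summable b hb a ha).hasSum.tendsto_sum_nat
  filter_upwards [eventually_ge_atTop L] with M hM
  have h1 := UU_anti b hb a ha hM
  have h2 : (0 : ℝ) ≤ (b : ℝ) ^ (-(M : ℤ)) := by positivity
  have h3 : UU b a M = SS b a M + (b : ℝ) ^ (-(M : ℤ)) := rfl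
  change SS b a M ≤ _
  linarith

lemma tsum_lower (b : ℕ) (hb : 2 ≤ b) (a : ℕ → ℕ) (ha : ∀ r, a r < b) (k r l : ℕ)
    (hk : k ≤ r) (hl : r < l) (h : 1 ≤ a r) :
    SS b a k + (b : ℝ) ^ (-(l : ℤ)) ≤ ∑' r : ℕ, (a r : ℝ) * (b : ℝ) ^ (-(r + 1 : ℤ)) := by
  have h1 := SS_le_tsum b hb a ha (r + 1)
  rw [SS_succ] at h1
  have h2 := SS_mono b a hk
  have h3 := zpow_anti_aux b hb (show r + 1 ≤ l by omega)
  push_cast at h3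
  have h4 : (1 : ℝ) ≤ a r := by exact_mod_cast h
  have h5 : (0 : ℝ) ≤ (b : ℝ) ^ (-(r + 1 : ℤ)) := by positivity
  nlinarith

lemma tsum_upper (b : ℕ) (hb : 2 ≤ b) (a : ℕ → ℕ) (ha : ∀ r, a r < b) (k r l : ℕ)
    (hk : k ≤ r) (hl : r < l) (h : a r + 2 ≤ b) :
    ∑' r : ℕ, (a r : ℝ) * (b : ℝ) ^ (-(r + 1 : ℤ)) + (b : ℝ) ^ (-(l : ℤ)) ≤
      SS b a k + (b : ℝ) ^ (-(k : ℤ)) := by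
  have h1 := tsum_le_UU b hb a ha (r + 1)
  rw [UU_succ b hb] at h1
  have h2 := UU_anti b hb a ha hk
  have h3 := zpow_anti_aux b hb (show r + 1 ≤ l by omega)
  push_cast at h3
  have h4 : (a r : ℝ) + 2 ≤ b := by exact_mod_cast h
  have h5 : (0 : ℝ) ≤ (b : ℝ) ^ (-(r + 1 : ℤ)) := by positivity
  have h6 : UU b a k = SS b a k + (b : ℝ) ^ (-(k : ℤ)) := rfl
  nlinarith

/-! ### The exponents -/

lemma sig_pos (m n : ℕ) (hm : 2 ≤ m) (hmn : m < n) : 0 < sig m n := by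
  apply div_pos <;> apply Real.log_pos <;> exact_mod_cast (by omega)

lemma sig_lt_one (m n : ℕ) (hm : 2 ≤ m) (hmn : m < n) : sig m n < 1 := by
  have h : 0 < Real.log n := Real.log_pos (by exact_mod_cast (by omega))
  rw [sig, div_lt_one h]
  apply Real.log_lt_log
  · exact_mod_cast (by omega)
  · exact_mod_cast hmn

lemma lk_le (m n k : ℕ) (hm : 2 ≤ m) (hmn : m < n) : lk m n k ≤ k := by
  rw [lk]
  apply Nat.floor_le_of_le
  have := sig_lt_one m n hm hmn
  have h2 : (0 : ℝ) ≤ k := by positivity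
  nlinarith

lemma rpow_sig (m n k : ℕ) (hm : 2 ≤ m) (hmn : m < n) :
    (n : ℝ) ^ (sig m n * k) = (m : ℝ) ^ (k : ℝ) := by
  have h : 0 < Real.log n := Real.log_pos (by exact_mod_cast (by omega))
  have hn : (0 : ℝ) < n := by exact_mod_cast (by omega)
  have hm' : (0 : ℝ) < m := by exact_mod_cast (by omega)
  rw [Real.rpow_def_of_pos hn, Real.rpow_def_of_pos hm', sig]
  congr 1
  field_simp

lemma side_lower (m n k : ℕ) (hm : 2 ≤ m) (hmn : m < n) :
    (m : ℝ) ^ (-(k : ℤ)) ≤ (n : ℝ) ^ (-(lk m n k : ℤ)) := by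
  have hn : (1 : ℝ) ≤ n := by exact_mod_cast (by omega)
  have hm' : (0 : ℝ) < m := by exact_mod_cast (by omega)
  have h1 : (lk m n k : ℝ) ≤ sig m n * k :=
    Nat.floor_le (by have := sig_pos m n hm hmn; positivity)
  have h2 := Real.rpow_le_rpow_of_exponent_le hn h1
  rw [rpow_sig m n k hm hmn, Real.rpow_natCast, Real.rpow_natCast] at h2
  rw [zpow_neg, zpow_neg, zpow_natCast, zpow_natCast]
  apply inv_anti₀ (by positivity) h2

lemma side_upper (m n k : ℕ) (hm : 2 ≤ m) (hmn : m < n) :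
    (n : ℝ) ^ (-(lk m n k : ℤ)) ≤ n * (m : ℝ) ^ (-(k : ℤ)) := by
  have hn : (1 : ℝ) ≤ n := by exact_mod_cast (by omega)
  have hm' : (0 : ℝ) < m := by exact_mod_cast (by omega)
  have h1 : sig m n * k ≤ ((lk m n k + 1 : ℕ) : ℝ) := by
    push_cast
    exact (Nat.lt_floor_add_one _).le
  have h2 := Real.rpow_le_rpow_of_exponent_le hn h1
  rw [rpow_sig m n k hm hmn, Real.rpow_natCast, Real.rpow_natCast] at h2
  rw [zpow_neg, zpow_neg, zpow_natCast, zpow_natCast]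
  rw [pow_succ] at h2
  rw [← div_eq_mul_inv, inv_eq_one_div, div_le_div_iff₀ (by positivity) (by positivity)]
  linarith

/-! ### The measure -/

lemma Tmap_cont (m n : ℕ) (d : ℕ × ℕ) : Continuous (Tmap m n d) := by
  unfold Tmap
  fun_prop

lemma Tmap_contract (m n : ℕ) (hm : 2 ≤ m) (hmn : m < n) (d : ℕ × ℕ) (z z' : ℝ × ℝ) :
    dist (Tmap m n d z) (Tmap m n d z') ≤ dist z z' / 2 := by
  have hm2 : (2 : ℝ) ≤ m := by exact_mod_cast hm
  have hn2 : (2 : ℝ) ≤ n := by exact_mod_cast (by omega)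
  have h1 : |z.1 - z'.1| ≤ dist z z' := by rw [← Real.dist_eq]; exact le_max_left _ _
  have h2 : |z.2 - z'.2| ≤ dist z z' := by rw [← Real.dist_eq]; exact le_max_right _ _
  rw [Prod.dist_eq]
  simp only [Tmap, Real.dist_eq]
  apply max_le
  · rw [← sub_div, add_sub_add_right_eq_sub, abs_div, abs_of_pos (show (0 : ℝ) < n by linarith)]
    gcongr
  · rw [← sub_div, add_sub_add_right_eq_sub, abs_div, abs_of_pos (show (0 : ℝ) < m by linarith)]
    gcongr

lemma coord_cent (b j : ℕ) (hb : 2 ≤ b) (hj : j < b) (x s : ℝ) (hs : 0 ≤ s)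
    (h : |x - 1 / 2| ≤ 1 / 2 + s) : |(x + j) / b - 1 / 2| ≤ 1 / 2 + s / 2 := by
  have hb2 : (2 : ℝ) ≤ b := by exact_mod_cast hb
  have hj1 : (j : ℝ) + 1 ≤ b := by exact_mod_cast hj
  have hj0 : (0 : ℝ) ≤ j := by positivity
  have hb0 : (0 : ℝ) < b := by linarith
  rw [abs_le] at h ⊢
  constructor
  · have : -(s / 2) ≤ (x + j) / b := by
      rw [le_div_iff₀ hb0]; nlinarith
    linarith
  · have : (x + j) / b ≤ 1 + s / 2 := by
      rw [div_le_iff₀ hb0]; nlinarith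
    linarith

def cent : ℝ × ℝ := (1 / 2, 1 / 2)

lemma Tmap_cent (m n : ℕ) (hm : 2 ≤ m) (hmn : m < n) (d : ℕ × ℕ) (hd : d.1 < m ∧ d.2 < n)
    (z : ℝ × ℝ) (s : ℝ) (hs : 0 ≤ s) (h : dist z cent ≤ 1 / 2 + s) :
    dist (Tmap m n d z) cent ≤ 1 / 2 + s / 2 := by
  rw [Prod.dist_eq] at h ⊢
  have h1 := (le_max_left _ _).trans h
  have h2 := (le_max_right _ _).trans h
  rw [Real.dist_eq] at h1 h2
  apply max_le
  · rw [Real.dist_eq]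
    exact coord_cent n d.2 (by omega) hd.2 _ s hs h1
  · rw [Real.dist_eq]
    exact coord_cent m d.1 hm hd.1 _ s hs h2

lemma ofReal_sum_one (D : Finset (ℕ × ℕ)) (p : ℕ × ℕ → ℝ) (hp : ∀ d ∈ D, 0 < p d)
    (hp1 : ∑ d ∈ D, p d = 1) : ∑ d ∈ D, ENNReal.ofReal (p d) = 1 := by
  rw [← ENNReal.ofReal_sum_of_nonneg (fun d hd => (hp d hd).le), hp1, ENNReal.ofReal_one]

lemma selfaffine_le (m n : ℕ) (D : Finset (ℕ × ℕ)) (p : ℕ × ℕ → ℝ) (hp : ∀ d ∈ D, 0 < p d)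
    (hp1 : ∑ d ∈ D, p d = 1) (μ : Measure (ℝ × ℝ)) (hμ : IsSelfAffine m n D p μ)
    (A : Set (ℝ × ℝ)) (hA : MeasurableSet A) (c : ℝ≥0∞)
    (h : ∀ d ∈ D, μ (Tmap m n d ⁻¹' A) ≤ c) : μ A ≤ c := by
  rw [hμ A hA]
  calc _ ≤ ∑ d ∈ D, ENNReal.ofReal (p d) * c := by
        apply Finset.sum_le_sum
        intro d hd
        gcongr
        exact h d hd
    _ = c := by rw [← Finset.sum_mul, ofReal_sum_one D p hp hp1, one_mul]

lemma far_null (m n : ℕ) (hm : 2 ≤ m) (hmn : m < n)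
    (D : Finset (ℕ × ℕ)) (hD : ∀ d ∈ D, d.1 < m ∧ d.2 < n)
    (p : ℕ × ℕ → ℝ) (hp : ∀ d ∈ D, 0 < p d) (hp1 : ∑ d ∈ D, p d = 1)
    (μ : Measure (ℝ × ℝ)) (hμ1 : IsProbabilityMeasure μ) (hμ : IsSelfAffine m n D p μ) :
    μ (closedBall cent (1 / 2))ᶜ = 0 := by
  let F : ℝ → Set (ℝ × ℝ) := fun s => {z | 1 / 2 + s < dist z cent}
  have hF : ∀ s, MeasurableSet (F s) := fun s =>
    (isOpen_lt continuous_const (by fun_prop)).measurableSet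
  have step : ∀ s, 0 ≤ s → μ (F s) ≤ μ (F (2 * s)) := by
    intro s hs
    apply selfaffine_le m n D p hp hp1 μ hμ _ (hF s)
    intro d hd
    apply measure_mono
    intro z hz
    by_contra hcon
    have h1 : dist z cent ≤ 1 / 2 + 2 * s := not_lt.1 hcon
    have h2 := Tmap_cent m n hm hmn d (hD d hd) z (2 * s) (by linarith) h1
    have h3 : 1 / 2 + s < dist (Tmap m n d z) cent := hz
    linarith
  have step2 : ∀ s, 0 ≤ s → ∀ N : ℕ, μ (F s) ≤ μ (F (2 ^ N * s)) := by
    intro s hs N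
    induction N with
    | zero => simp
    | succ N ih =>
      refine ih.trans ((step _ (by positivity)).trans (le_of_eq ?_))
      congr 2; ring
  have zero : ∀ s, 0 < s → μ (F s) = 0 := by
    intro s hs
    have hanti : Antitone (fun N : ℕ => F (2 ^ N * s)) := by
      intro a b hab z hz
      have hz' : 1 / 2 + 2 ^ b * s < dist z cent := hz
      have : (2 : ℝ) ^ a ≤ 2 ^ b := pow_le_pow_right₀ (by norm_num) hab
      show 1 / 2 + 2 ^ a * s < dist z cent
      nlinarith
    have ht := tendsto_measure_iInter_atTop (μ := μ)
      (fun N => (hF (2 ^ N * s)).nullMeasurableSet) hanti ⟨0, measure_ne_top _ _⟩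
    have hemp : ⋂ N : ℕ, F (2 ^ N * s) = ∅ := by
      rw [Set.eq_empty_iff_forall_notMem]
      intro z hz
      rw [Set.mem_iInter] at hz
      obtain ⟨N, hN⟩ := pow_unbounded_of_one_lt (dist z cent / s) (by norm_num : (1 : ℝ) < 2)
      rw [div_lt_iff₀ hs] at hN
      have : 1 / 2 + 2 ^ N * s < dist z cent := hz N
      linarith
    rw [hemp, measure_empty] at ht
    exact le_antisymm (ge_of_tendsto' ht (step2 s hs.le)) bot_le
  have hsub : (closedBall cent (1 / 2))ᶜ ⊆ ⋃ N : ℕ, F (1 / ((N : ℝ) + 1)) := by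
    intro z hz
    rw [Set.mem_compl_iff, mem_closedBall, not_le] at hz
    obtain ⟨N, hN⟩ := exists_nat_one_div_lt (sub_pos.2 hz)
    rw [Set.mem_iUnion]
    refine ⟨N, ?_⟩
    show 1 / 2 + 1 / ((N : ℝ) + 1) < dist z cent
    linarith
  exact measure_mono_null hsub (measure_iUnion_null fun N => zero _ (by positivity))

def EE (m n : ℕ) (D : Finset (ℕ × ℕ)) : ℕ → Set (ℝ × ℝ)
  | 0 => closedBall cent (1 / 2)
  | k + 1 => ⋃ d ∈ D, Tmap m n d '' EE m n D k

lemma EE_compact (m n : ℕ) (D : Finset (ℕ × ℕ)) (k : ℕ) : IsCompact (EE m n D k) := by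
  induction k with
  | zero => exact isCompact_closedBall _ _
  | succ k ih =>
    exact D.isCompact_biUnion fun d _ => ih.image (Tmap_cont m n d)

lemma EE_null (m n : ℕ) (hm : 2 ≤ m) (hmn : m < n)
    (D : Finset (ℕ × ℕ)) (hD : ∀ d ∈ D, d.1 < m ∧ d.2 < n)
    (p : ℕ × ℕ → ℝ) (hp : ∀ d ∈ D, 0 < p d) (hp1 : ∑ d ∈ D, p d = 1)
    (μ : Measure (ℝ × ℝ)) (hμ1 : IsProbabilityMeasure μ) (hμ : IsSelfAffine m n D p μ)
    (k : ℕ) : μ (EE m n D k)ᶜ = 0 := by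
  induction k with
  | zero => exact far_null m n hm hmn D hD p hp hp1 μ hμ1 hμ
  | succ k ih =>
    refine le_antisymm ?_ bot_le
    apply selfaffine_le m n D p hp hp1 μ hμ _ (EE_compact m n D (k + 1)).measurableSet.compl
    intro d hd
    rw [← ih]
    apply measure_mono
    intro z hz hz2
    apply hz
    exact Set.mem_biUnion (show d ∈ (D : Set (ℕ × ℕ)) from hd) ⟨z, hz2, rfl⟩

lemma coord_T (b : ℕ) (hb : 2 ≤ b) (a : ℕ → ℕ) (L : ℕ) (x : ℝ)
    (h : x ∈ Icc (SS b (fun r => a (r + 1)) L) (UU b (fun r => a (r + 1)) L)) :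
    (x + a 0) / b ∈ Icc (SS b a (L + 1)) (UU b a (L + 1)) := by
  have hb0 : (0 : ℝ) < b := by positivity
  have hz : (b : ℝ) ^ (-((L + 1 : ℕ) : ℤ)) = (b : ℝ) ^ (-(L : ℤ)) / b := by
    rw [zpow_neg_succ_aux b hb L]; push_cast; field_simp
  rw [UU, SS_shift b hb, hz, ← add_div]
  unfold UU at h
  constructor
  · have := h.1; gcongr
  · have := h.2
    apply div_le_div_of_nonneg_right _ hb0.le
    linarith

lemma SS_zero (b : ℕ) (a : ℕ → ℕ) : SS b a 0 = 0 := by simp [SS]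

lemma UU_zero (b : ℕ) (a : ℕ → ℕ) : UU b a 0 = 1 := by simp [UU, SS]

lemma cent_mem (z : ℝ × ℝ) (h : dist z cent ≤ 1 / 2) :
    z.1 ∈ Icc (0 : ℝ) 1 ∧ z.2 ∈ Icc (0 : ℝ) 1 := by
  rw [Prod.dist_eq] at h
  have h1 := (le_max_left _ _).trans h
  have h2 := (le_max_right _ _).trans h
  rw [Real.dist_eq, abs_le] at h1 h2
  simp only [cent] at h1 h2
  exact ⟨⟨by linarith, by linarith⟩, ⟨by linarith, by linarith⟩⟩

lemma EE_word (m n : ℕ) (hm : 2 ≤ m) (hmn : m < n)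
    (D : Finset (ℕ × ℕ)) (hD : ∀ d ∈ D, d.1 < m ∧ d.2 < n) (w0 : Word D) (k : ℕ) :
    ∀ z ∈ EE m n D k, ∃ i : Word D, ∀ L ≤ k,
      z.1 ∈ Icc (SS n (fun r => (i r).1.2) L) (UU n (fun r => (i r).1.2) L) ∧
      z.2 ∈ Icc (SS m (fun r => (i r).1.1) L) (UU m (fun r => (i r).1.1) L) := by
  induction k with
  | zero =>
    intro z hz
    refine ⟨w0, fun L hL => ?_⟩
    obtain rfl : L = 0 := by omega
    rw [SS_zero, SS_zero, UU_zero, UU_zero]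
    exact cent_mem z hz
  | succ k ih =>
    intro z hz
    have hz' := hz
    simp only [EE, Set.mem_iUnion] at hz
    obtain ⟨d, hd, z', hz2, rfl⟩ := hz
    obtain ⟨i', hi'⟩ := ih z' hz2
    let i : Word D := fun r => Nat.casesOn r ⟨d, hd⟩ i'
    refine ⟨i, fun L hL => ?_⟩
    rcases L with _ | L
    · rw [SS_zero, SS_zero, UU_zero, UU_zero]
      have hc : ∀ k, ∀ z ∈ EE m n D k, dist z cent ≤ 1 / 2 := by
        intro k
        induction k with
        | zero => intro z hz; exact hz
        | succ k ih2 =>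
          intro z hz
          simp only [EE, Set.mem_iUnion] at hz
          obtain ⟨d, hd, z', hz2, rfl⟩ := hz
          have := Tmap_cent m n hm hmn d (hD d hd) z' 0 le_rfl (by linarith [ih2 z' hz2])
          linarith
      exact cent_mem _ (hc _ _ hz')
    · have := hi' L (by omega)
      exact ⟨coord_T n (by omega) (fun r => (i r).1.2) L _ this.1,
        coord_T m hm (fun r => (i r).1.1) L _ this.2⟩

lemma ball_pos (m n : ℕ) (hm : 2 ≤ m) (hmn : m < n)
    (D : Finset (ℕ × ℕ)) (p : ℕ × ℕ → ℝ) (hp : ∀ d ∈ D, 0 < p d)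
    (μ : Measure (ℝ × ℝ)) (hμ1 : IsProbabilityMeasure μ) (hμ : IsSelfAffine m n D p μ)
    (hnull : μ (closedBall cent (1 / 2))ᶜ = 0)
    (Λ : Set (ℝ × ℝ)) (hΛ : IsAttractor m n D Λ) (x : ℝ × ℝ) (hx : x ∈ Λ) (r : ℝ) (hr : 0 < r) :
    μ (ball x r) ≠ 0 := by
  obtain ⟨R, hR⟩ := hΛ.1.isBounded.subset_closedBall cent
  let R0 : ℝ := |R| + 1
  have key : ∀ N : ℕ, ∀ z ∈ Λ, μ (ball z (R0 / 2 ^ N)) ≠ 0 := by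
    intro N
    induction N with
    | zero =>
      intro z hz h0
      have hsub : closedBall cent (1 / 2) ⊆ ball z (R0 / 2 ^ 0) := by
        intro y hy
        have h1 : dist z cent ≤ R := hR hz
        have h2 : dist y cent ≤ 1 / 2 := hy
        have h3 := dist_triangle_right y z cent
        rw [mem_ball]
        have : R ≤ |R| := le_abs_self R
        simp only [R0, pow_zero, div_one]
        linarith
      have h1 : μ (closedBall cent (1 / 2)) = 0 := measure_mono_null hsub h0
      have h2 : μ Set.univ = 0 := by
        rw [← Set.union_compl_self (closedBall cent (1 / 2))]
        exact measure_union_null h1 hnull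
      simp at h2
    | succ N ih =>
      intro z hz
      have hz' := hz
      rw [hΛ.2.2] at hz'
      simp only [Set.mem_iUnion] at hz'
      obtain ⟨d, hd, z', hz2, rfl⟩ := hz'
      intro h0
      rw [hμ _ measurableSet_ball, Finset.sum_eq_zero_iff] at h0
      have h1 := h0 d hd
      rw [mul_eq_zero] at h1
      rcases h1 with h1 | h1
      · rw [ENNReal.ofReal_eq_zero] at h1
        linarith [hp d hd]
      · apply ih z' hz2
        refine measure_mono_null ?_ h1
        intro y hy
        rw [mem_ball] at hy
        rw [Set.mem_preimage, mem_ball]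
        have := Tmap_contract m n hm hmn d y z'
        have e : R0 / 2 ^ (N + 1) = R0 / 2 ^ N / 2 := by rw [pow_succ]; field_simp
        rw [e]
        linarith
  obtain ⟨N, hN⟩ := pow_unbounded_of_one_lt (R0 / r) (by norm_num : (1 : ℝ) < 2)
  intro h0
  apply key N x hx
  refine measure_mono_null (ball_subset_ball ?_) h0
  rw [div_lt_iff₀ hr] at hN
  rw [div_le_iff₀ (by positivity)]
  linarith

/-! ### Positivity of the local dimension -/

lemma top_null (m n : ℕ) (hm : 2 ≤ m) (D : Finset (ℕ × ℕ)) (hD : ∀ d ∈ D, d.1 < m ∧ d.2 < n)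
    (p : ℕ × ℕ → ℝ) (hp : ∀ d ∈ D, 0 < p d)
    (μ : Measure (ℝ × ℝ)) (hμ1 : IsProbabilityMeasure μ) (hμ : IsSelfAffine m n D p μ)
    (hnull : μ (closedBall cent (1 / 2))ᶜ = 0) (q : ℝ) (hq0 : 0 < q) (hq1 : q < 1)
    (hq : ∀ i, ∑ d ∈ D with d.1 = i, p d ≤ q) :
    μ {z | z.2 = 1} = 0 := by
  have hmeas : MeasurableSet {z : ℝ × ℝ | z.2 = 1} :=
    (isClosed_eq continuous_snd continuous_const).measurableSet
  have hm2 : (2 : ℝ) ≤ m := by exact_mod_cast hm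
  have h := hμ _ hmeas
  have hle : μ {z : ℝ × ℝ | z.2 = 1} ≤ ENNReal.ofReal q * μ {z : ℝ × ℝ | z.2 = 1} := by
    calc μ {z : ℝ × ℝ | z.2 = 1} = _ := h
      _ ≤ ∑ d ∈ D, if d.1 = m - 1 then ENNReal.ofReal (p d) * μ {z : ℝ × ℝ | z.2 = 1} else 0 := by
        apply Finset.sum_le_sum
        intro d hd
        split_ifs with hdm
        · gcongr
          intro z hz
          have hz' : (z.2 + d.1) / m = 1 := hz
          have : (d.1 : ℝ) = m - 1 := by rw [hdm]; push_cast [show 1 ≤ m by omega]; ring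
          rw [div_eq_one_iff_eq (by linarith), this] at hz'
          show z.2 = 1
          linarith
        · have : μ (Tmap m n d ⁻¹' {z : ℝ × ℝ | z.2 = 1}) = 0 := by
            refine measure_mono_null ?_ hnull
            intro z hz hz2
            have hz' : (z.2 + d.1) / m = 1 := hz
            rw [div_eq_one_iff_eq (by linarith)] at hz'
            have h3 := (cent_mem z hz2).2.2
            have h4 := (hD d hd).1
            have h5 : (d.1 : ℝ) + 2 ≤ m := by exact_mod_cast (by omega)
            linarith
          rw [this, mul_zero]
      _ = ENNReal.ofReal (∑ d ∈ D with d.1 = m - 1, p d) * μ {z : ℝ × ℝ | z.2 = 1} := by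
        rw [← Finset.sum_filter, ← Finset.sum_mul, ENNReal.ofReal_sum_of_nonneg]
        intro d hd
        exact (hp d (Finset.mem_filter.1 hd).1).le
      _ ≤ _ := by gcongr; exact hq _
  by_contra hne
  have hlt : ENNReal.ofReal q * μ {z : ℝ × ℝ | z.2 = 1} < 1 * μ {z : ℝ × ℝ | z.2 = 1} := by
    apply ENNReal.mul_lt_mul_left hne (measure_ne_top _ _)
    rw [← ENNReal.ofReal_one]
    exact (ENNReal.ofReal_lt_ofReal_iff (by norm_num)).2 hq1
  rw [one_mul] at hlt
  exact absurd hle (not_le.2 hlt)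

lemma strip_le (m n : ℕ) (hm : 2 ≤ m) (D : Finset (ℕ × ℕ))
    (p : ℕ × ℕ → ℝ) (hp : ∀ d ∈ D, 0 < p d)
    (μ : Measure (ℝ × ℝ)) (hμ1 : IsProbabilityMeasure μ) (hμ : IsSelfAffine m n D p μ)
    (hnull : μ (closedBall cent (1 / 2))ᶜ = 0) (htop : μ {z | z.2 = 1} = 0)
    (q : ℝ) (hq0 : 0 < q)
    (hq : ∀ i, ∑ d ∈ D with d.1 = i, p d ≤ q) (k : ℕ) : ∀ a : ℤ,
    μ {z | ⌊(m : ℝ) ^ k * z.2⌋ = a} ≤ ENNReal.ofReal (q ^ k) := by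
  have hm2 : (2 : ℝ) ≤ m := by exact_mod_cast hm
  induction k with
  | zero => intro a; simpa using prob_le_one
  | succ k ih =>
    intro a
    have hmeas : MeasurableSet {z : ℝ × ℝ | ⌊(m : ℝ) ^ (k + 1) * z.2⌋ = a} :=
      (Int.measurable_floor.comp (by fun_prop : Measurable fun z : ℝ × ℝ => (m : ℝ) ^ (k + 1) * z.2))
        (measurableSet_singleton a)
    have hpre : ∀ d : ℕ × ℕ, Tmap m n d ⁻¹' {z : ℝ × ℝ | ⌊(m : ℝ) ^ (k + 1) * z.2⌋ = a} =
        {z | ⌊(m : ℝ) ^ k * z.2⌋ = a - ((m ^ k * d.1 : ℕ) : ℤ)} := by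
      intro d
      ext z
      simp only [Set.mem_preimage, Set.mem_ofPred_eq, Tmap]
      have : (m : ℝ) ^ (k + 1) * ((z.2 + d.1) / m) = (m : ℝ) ^ k * z.2 + ((m ^ k * d.1 : ℕ) : ℤ) := by
        push_cast
        rw [pow_succ]
        field_simp
      rw [this, Int.floor_add_intCast]
      constructor <;> intro h <;> omega
    rw [hμ _ hmeas]
    calc _ ≤ ∑ d ∈ D, if d.1 = (a / ((m ^ k : ℕ) : ℤ)).toNat then
            ENNReal.ofReal (p d) * ENNReal.ofReal (q ^ k) else 0 := by
          apply Finset.sum_le_sum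
          intro d hd
          rw [hpre d]
          split_ifs with hdm
          · gcongr
            exact ih _
          · have : μ {z : ℝ × ℝ | ⌊(m : ℝ) ^ k * z.2⌋ = a - ((m ^ k * d.1 : ℕ) : ℤ)} = 0 := by
              refine measure_mono_null ?_ (measure_union_null hnull htop)
              intro z hz
              by_contra hcon
              rw [Set.mem_union, not_or, Set.mem_compl_iff, not_not] at hcon
              obtain ⟨h0, h1⟩ := (cent_mem z hcon.1).2
              have h1' : z.2 < 1 := lt_of_le_of_ne h1 hcon.2
              have hz' : ⌊(m : ℝ) ^ k * z.2⌋ = a - ((m ^ k * d.1 : ℕ) : ℤ) := hz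
              have hmk : (0 : ℝ) < (m : ℝ) ^ k := by positivity
              have e0 : 0 ≤ ⌊(m : ℝ) ^ k * z.2⌋ := Int.floor_nonneg.2 (by positivity)
              have e1 : ⌊(m : ℝ) ^ k * z.2⌋ < ((m ^ k : ℕ) : ℤ) := by
                rw [Int.floor_lt]
                push_cast
                nlinarith
              apply hdm
              have hM : (0 : ℤ) < ((m ^ k : ℕ) : ℤ) := by positivity
              have : a / ((m ^ k : ℕ) : ℤ) = d.1 := by
                rw [Int.ediv_eq_iff_of_pos hM]
                push_cast at *
                constructor <;> nlinarith
              rw [this]; simp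
            rw [this, mul_zero]
      _ = ENNReal.ofReal (∑ d ∈ D with d.1 = (a / ((m ^ k : ℕ) : ℤ)).toNat, p d) *
            ENNReal.ofReal (q ^ k) := by
        rw [← Finset.sum_filter, ← Finset.sum_mul, ENNReal.ofReal_sum_of_nonneg]
        intro d hd
        exact (hp d (Finset.mem_filter.1 hd).1).le
      _ ≤ ENNReal.ofReal q * ENNReal.ofReal (q ^ k) := by gcongr; exact hq _
      _ = ENNReal.ofReal (q ^ (k + 1)) := by
        rw [← ENNReal.ofReal_mul hq0.le, pow_succ, mul_comm]

lemma ball_le (m n : ℕ) (hm : 2 ≤ m) (hmn : m < n)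
    (D : Finset (ℕ × ℕ)) (hD : ∀ d ∈ D, d.1 < m ∧ d.2 < n)
    (hrow : ∃ d ∈ D, ∃ d' ∈ D, d.1 ≠ d'.1)
    (p : ℕ × ℕ → ℝ) (hp : ∀ d ∈ D, 0 < p d) (hp1 : ∑ d ∈ D, p d = 1)
    (μ : Measure (ℝ × ℝ)) (hμ1 : IsProbabilityMeasure μ) (hμ : IsSelfAffine m n D p μ) :
    ∃ q : ℝ, 0 < q ∧ q < 1 ∧ ∀ (x : ℝ × ℝ) (k : ℕ),
      μ (ball x ((m : ℝ) ^ (-(k : ℤ)))) ≤ ENNReal.ofReal (3 * q ^ k) := by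
  have hnull := far_null m n hm hmn D hD p hp hp1 μ hμ1 hμ
  obtain ⟨d, hd, d', hd', hne⟩ := hrow
  let q : ℝ := max (1 / 2) (1 - min (p d) (p d'))
  have hq0 : 0 < q := lt_of_lt_of_le (by norm_num) (le_max_left _ _)
  have hq1 : q < 1 := by
    apply max_lt (by norm_num)
    have : 0 < min (p d) (p d') := lt_min (hp d hd) (hp d' hd')
    linarith
  have hq : ∀ i, ∑ e ∈ D with e.1 = i, p e ≤ q := by
    intro i
    have : ∃ e ∈ D, e.1 ≠ i ∧ min (p d) (p d') ≤ p e := by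
      by_cases h : d.1 = i
      · exact ⟨d', hd', fun h' => hne (h.trans h'.symm), min_le_right _ _⟩
      · exact ⟨d, hd, h, min_le_left _ _⟩
    obtain ⟨e, he, hei, hmin⟩ := this
    refine le_trans ?_ (le_max_right _ _)
    have h1 := Finset.sum_filter_add_sum_filter_not D (fun e => e.1 = i) p
    have h2 : p e ≤ ∑ e ∈ D with ¬ e.1 = i, p e :=
      Finset.single_le_sum (f := p) (fun e he => (hp e (Finset.mem_filter.1 he).1).le)
        (Finset.mem_filter.2 ⟨he, hei⟩)
    linarith
  have htop := top_null m n hm D hD p hp μ hμ1 hμ hnull q hq0 hq1 hq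
  refine ⟨q, hq0, hq1, fun x k => ?_⟩
  have hs := strip_le m n hm D p hp μ hμ1 hμ hnull htop q hq0 hq k
  have hmk : (0 : ℝ) < (m : ℝ) ^ k := by
    have : (0 : ℝ) < m := by exact_mod_cast (by omega)
    positivity
  let a : ℤ := ⌊(m : ℝ) ^ k * x.2⌋
  have hsub : ball x ((m : ℝ) ^ (-(k : ℤ))) ⊆
      ⋃ c ∈ Finset.Icc (a - 1) (a + 1), {z : ℝ × ℝ | ⌊(m : ℝ) ^ k * z.2⌋ = c} := by
    intro z hz
    rw [mem_ball, Prod.dist_eq] at hz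
    have h2 := lt_of_le_of_lt (le_max_right _ _) hz
    rw [Real.dist_eq, abs_lt, zpow_neg, zpow_natCast] at h2
    have h3 : (m : ℝ) ^ k * ((m : ℝ) ^ k)⁻¹ = 1 := mul_inv_cancel₀ hmk.ne'
    have u1 : (m : ℝ) ^ k * z.2 < (m : ℝ) ^ k * x.2 + 1 := by nlinarith
    have u2 : (m : ℝ) ^ k * x.2 - 1 < (m : ℝ) ^ k * z.2 := by nlinarith
    simp only [Set.mem_iUnion, Set.mem_ofPred_eq, exists_prop, exists_eq_right', Finset.mem_Icc]
    have v1 := Int.floor_le_floor u1.le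
    have v2 := Int.floor_le_floor u2.le
    rw [Int.floor_add_one] at v1
    rw [Int.floor_sub_one] at v2
    exact ⟨v2, v1⟩
  calc _ ≤ _ := measure_mono hsub
    _ ≤ _ := measure_biUnion_finset_le _ _
    _ ≤ ∑ c ∈ Finset.Icc (a - 1) (a + 1), ENNReal.ofReal (q ^ k) :=
      Finset.sum_le_sum fun c _ => hs c
    _ = ENNReal.ofReal (3 * q ^ k) := by
      rw [Finset.sum_const, Int.card_Icc, ENNReal.ofReal_mul (by norm_num)]
      have : (a + 1 + 1 - (a - 1)).toNat = 3 := by omega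
      rw [this, nsmul_eq_mul]
      simp

/-! ### Limits along geometric radii -/

lemma radius_limit (m : ℕ) (hm : 2 ≤ m) (μ : Measure (ℝ × ℝ)) (x : ℝ × ℝ) (α : ℝ)
    (h : HasLocalDim μ x α) (C a : ℝ) (hC : 0 < C) (ha : 0 < a) :
    Tendsto (fun k : ℕ => Real.log (μ (ball x (C * (m : ℝ) ^ (-(a * k))))).toReal / (k : ℝ))
      atTop (𝓝 (-(α * a * Real.log m))) := by
  have hm1 : (1 : ℝ) < m := by exact_mod_cast (by omega)
  have hm0 : (0 : ℝ) < m := by linarith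
  have hlm : 0 < Real.log m := Real.log_pos hm1
  have hlog : ∀ k : ℕ, Real.log (C * (m : ℝ) ^ (-(a * k))) = Real.log C - a * Real.log m * k := by
    intro k
    rw [Real.log_mul hC.ne' (by positivity), Real.log_rpow hm0]
    ring
  have hbot : Tendsto (fun k : ℕ => Real.log (C * (m : ℝ) ^ (-(a * k)))) atTop atBot := by
    simp_rw [hlog, sub_eq_add_neg]
    apply tendsto_atBot_add_const_left
    apply tendsto_neg_atTop_atBot.comp
    exact Tendsto.const_mul_atTop (by positivity) tendsto_natCast_atTop_atTop
  have hr : Tendsto (fun k : ℕ => C * (m : ℝ) ^ (-(a * k))) atTop (𝓝[>] 0) := by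
    rw [tendsto_nhdsWithin_iff]
    constructor
    · have := Real.tendsto_exp_atBot.comp hbot
      refine this.congr fun k => ?_
      simp only [Function.comp]
      rw [Real.exp_log (by positivity)]
    · exact Eventually.of_forall fun k => by
        show 0 < C * (m : ℝ) ^ (-(a * k))
        positivity
  have h1 := h.comp hr
  have h2 : Tendsto (fun k : ℕ => Real.log (C * (m : ℝ) ^ (-(a * k))) / (k : ℝ)) atTop
      (𝓝 (-(a * Real.log m))) := by
    have h3 : Tendsto (fun k : ℕ => Real.log C / (k : ℝ) - a * Real.log m) atTop
        (𝓝 (0 - a * Real.log m)) :=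
      (tendsto_const_div_atTop_nhds_zero_nat _).sub_const _
    rw [zero_sub] at h3
    refine h3.congr' ?_
    filter_upwards [eventually_gt_atTop 0] with k hk
    have : (k : ℝ) ≠ 0 := by positivity
    rw [hlog]
    field_simp
  have h4 := h1.mul h2
  have e : α * -(a * Real.log m) = -(α * a * Real.log m) := by ring
  rw [e] at h4
  refine h4.congr' ?_
  filter_upwards [hbot.eventually_lt_atBot 0] with k hk
  simp only [Function.comp]
  field_simp [hk.ne]

lemma alpha_pos (m n : ℕ) (hm : 2 ≤ m) (hmn : m < n)
    (D : Finset (ℕ × ℕ)) (hD : ∀ d ∈ D, d.1 < m ∧ d.2 < n)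
    (hrow : ∃ d ∈ D, ∃ d' ∈ D, d.1 ≠ d'.1)
    (p : ℕ × ℕ → ℝ) (hp : ∀ d ∈ D, 0 < p d) (hp1 : ∑ d ∈ D, p d = 1)
    (μ : Measure (ℝ × ℝ)) (hμ1 : IsProbabilityMeasure μ) (hμ : IsSelfAffine m n D p μ)
    (x : ℝ × ℝ) (hpos : ∀ r > 0, μ (ball x r) ≠ 0) (α : ℝ) (h : HasLocalDim μ x α) : 0 < α := by
  obtain ⟨q, hq0, hq1, hq⟩ := ball_le m n hm hmn D hD hrow p hp hp1 μ hμ1 hμ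
  have hm1 : (1 : ℝ) < m := by exact_mod_cast (by omega)
  have hlm : 0 < Real.log m := Real.log_pos hm1
  have h1 := radius_limit m hm μ x α h 1 1 one_pos one_pos
  have h2 : Tendsto (fun k : ℕ => Real.log 3 / (k : ℝ) + Real.log q) atTop
      (𝓝 (0 + Real.log q)) := (tendsto_const_div_atTop_nhds_zero_nat _).add_const _
  have h3 : -(α * 1 * Real.log m) ≤ 0 + Real.log q := by
    apply le_of_tendsto_of_tendsto h1 h2
    filter_upwards [eventually_gt_atTop 0] with k hk
    have hk0 : (0 : ℝ) < k := by exact_mod_cast hk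
    have e : (1 : ℝ) * (m : ℝ) ^ (-(1 * (k : ℝ))) = (m : ℝ) ^ (-(k : ℤ)) := by
      rw [one_mul, one_mul, ← Real.rpow_intCast]; push_cast; rfl
    rw [e]
    have hp0 : (0 : ℝ) < (m : ℝ) ^ (-(k : ℤ)) := by positivity
    have hb := ENNReal.toReal_mono ENNReal.ofReal_ne_top (hq x k)
    rw [ENNReal.toReal_ofReal (by positivity)] at hb
    have hb2 := Real.log_le_log (ENNReal.toReal_pos (hpos _ hp0) (measure_ne_top _ _)) hb
    rw [Real.log_mul (by norm_num) (by positivity), Real.log_pow] at hb2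
    rw [div_le_iff₀ hk0]
    refine hb2.trans (le_of_eq ?_)
    field_simp
  have h4 := Real.log_neg hq0 hq1
  nlinarith

/-! ### Separation from the boundary of the strip -/

lemma Vk_exists (m : ℕ) {D : Finset (ℕ × ℕ)} (j : Word D) (k : ℕ) (c : ℝ) (hc : 0 ≤ c)
    (h : Vk m j k ≤ ENNReal.ofReal c) :
    ∃ l : ℕ, k < l ∧ ((j (l - 1)).1.1 ∉ ({0, m - 1} : Set ℕ) ∨ (j (l - 1)).1.1 ≠ (j k).1.1) ∧
      (l : ℝ) ≤ c + k + 1 := by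
  classical
  unfold Vk at h
  rw [tsub_le_iff_right] at h
  by_cases hex : ∃ l : ℕ, k < l ∧
      ((j (l - 1)).1.1 ∉ ({0, m - 1} : Set ℕ) ∨ (j (l - 1)).1.1 ≠ (j k).1.1)
  · refine ⟨Nat.find hex, (Nat.find_spec hex).1, (Nat.find_spec hex).2, ?_⟩
    have h1 : ((Nat.find hex : ℕ) : ℝ≥0∞) ≤ ENNReal.ofReal c + (k + 1) := by
      refine le_trans ?_ h
      refine le_iInf₂ fun l hl => ?_
      exact_mod_cast Nat.find_min' hex hl
    have h2 := ENNReal.toReal_mono (by finiteness) h1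
    rw [ENNReal.toReal_add (by finiteness) (by finiteness), ENNReal.toReal_ofReal hc,
      ENNReal.toReal_add (by finiteness) (by finiteness)] at h2
    simp only [ENNReal.toReal_natCast, ENNReal.toReal_one] at h2
    linarith
  · exfalso
    have : (⨅ l ∈ {l : ℕ | k < l ∧
      ((j (l - 1)).1.1 ∉ ({0, m - 1} : Set ℕ) ∨ (j (l - 1)).1.1 ≠ (j k).1.1)}, (l : ℝ≥0∞)) = ⊤ := by
      rw [iInf₂_eq_top]
      intro l hl
      exact absurd ⟨l, hl⟩ hex
    rw [this, top_le_iff] at h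
    exact absurd h (by finiteness)

lemma strip_dist (m n : ℕ) (hm : 2 ≤ m) {D : Finset (ℕ × ℕ)} (hD : ∀ d ∈ D, d.1 < m ∧ d.2 < n)
    (j : Word D) (k l : ℕ) (hkl : k < l)
    (h : (j (l - 1)).1.1 ∉ ({0, m - 1} : Set ℕ) ∨ (j (l - 1)).1.1 ≠ (j k).1.1) :
    SS m (fun r => (j r).1.1) k + (m : ℝ) ^ (-(l : ℤ)) ≤ (proj m n j).2 ∧
    (proj m n j).2 + (m : ℝ) ^ (-(l : ℤ)) ≤ UU m (fun r => (j r).1.1) k := by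
  have ha : ∀ r, (fun r => (j r).1.1) r < m := fun r => (hD _ (j r).2).1
  have h1 : ∃ r, k ≤ r ∧ r < l ∧ 1 ≤ (j r).1.1 := by
    rcases h with h | h
    · refine ⟨l - 1, by omega, by omega, ?_⟩
      simp only [Set.mem_insert_iff, Set.mem_singleton_iff] at h
      omega
    · by_cases h0 : 1 ≤ (j k).1.1
      · exact ⟨k, le_rfl, hkl, h0⟩
      · exact ⟨l - 1, by omega, by omega, by omega⟩
  have h2 : ∃ r, k ≤ r ∧ r < l ∧ (j r).1.1 + 2 ≤ m := by
    have u := ha (l - 1)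
    have v := ha k
    simp only at u v
    rcases h with h | h
    · refine ⟨l - 1, by omega, by omega, ?_⟩
      simp only [Set.mem_insert_iff, Set.mem_singleton_iff] at h
      omega
    · by_cases h0 : (j k).1.1 + 2 ≤ m
      · exact ⟨k, le_rfl, hkl, h0⟩
      · exact ⟨l - 1, by omega, by omega, by omega⟩
  obtain ⟨r, hr1, hr2, hr3⟩ := h1
  obtain ⟨s, hs1, hs2, hs3⟩ := h2
  exact ⟨tsum_lower m hm _ ha k r l hr1 hr2 hr3, tsum_upper m hm _ ha k s l hs1 hs2 hs3⟩

lemma NN_eq_of_strip (b : ℕ) (hb : 2 ≤ b) (a a' : ℕ → ℕ) (k : ℕ) (y : ℝ)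
    (h : y ∈ Icc (SS b a' k) (UU b a' k)) (h1 : SS b a k < y) (h2 : y < UU b a k) :
    NN b a' k = NN b a k := by
  have hz : (0 : ℝ) < (b : ℝ) ^ (-(k : ℤ)) := by positivity
  obtain ⟨h3, h4⟩ := h
  unfold UU at h2 h4
  rw [SS_eq b hb] at h1 h2 h3 h4
  have u1 : (NN b a' k : ℝ) * (b : ℝ) ^ (-(k : ℤ)) < (NN b a k + 1) * (b : ℝ) ^ (-(k : ℤ)) := by
    linarith
  have u2 : (NN b a k : ℝ) * (b : ℝ) ^ (-(k : ℤ)) < (NN b a' k + 1) * (b : ℝ) ^ (-(k : ℤ)) := by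
    linarith
  have v1 := lt_of_mul_lt_mul_right u1 hz.le
  have v2 := lt_of_mul_lt_mul_right u2 hz.le
  have w1 : NN b a' k < NN b a k + 1 := by exact_mod_cast v1
  have w2 : NN b a k < NN b a' k + 1 := by exact_mod_cast v2
  omega

lemma approxSq_eq (m n : ℕ) {D : Finset (ℕ × ℕ)} (k : ℕ) (i : Word D) :
    approxSq m n k i =
      Icc (SS n (fun r => (i r).1.2) (lk m n k)) (UU n (fun r => (i r).1.2) (lk m n k)) ×ˢ
      Icc (SS m (fun r => (i r).1.1) k) (UU m (fun r => (i r).1.1) k) := rfl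

/-- The geometric core: a ball inside the strip is covered by three squares. -/
lemma exists_square (m n : ℕ) (hm : 2 ≤ m) (hmn : m < n)
    (D : Finset (ℕ × ℕ)) (hD : ∀ d ∈ D, d.1 < m ∧ d.2 < n)
    (p : ℕ × ℕ → ℝ) (hp : ∀ d ∈ D, 0 < p d) (hp1 : ∑ d ∈ D, p d = 1)
    (μ : Measure (ℝ × ℝ)) (hμ1 : IsProbabilityMeasure μ) (hμ : IsSelfAffine m n D p μ)
    (x : ℝ × ℝ) (j : Word D) (k : ℕ) (r : ℝ)
    (hrk : r ≤ (m : ℝ) ^ (-(k : ℤ)))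
    (h1 : SS m (fun r => (j r).1.1) k + r ≤ x.2) (h2 : x.2 + r ≤ UU m (fun r => (j r).1.1) k)
    (hpos : μ (ball x r) ≠ 0) :
    ∃ i : Word D, (∃ z ∈ approxSq m n k i, z ∈ ball x r) ∧ (∀ s < k, (i s).1.1 = (j s).1.1) ∧
      μ (ball x r) ≤ 3 * μ (approxSq m n k i) := by
  classical
  set L := lk m n k with hL
  have hn0 : (0 : ℝ) < n := by exact_mod_cast (by omega)
  let X : ℤ := ⌊(n : ℝ) ^ L * x.1⌋
  let F : ℤ → Set (ℝ × ℝ) := fun A => {z | z ∈ ball x r ∧ ∃ i : Word D,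
    (∀ s < k, (i s).1.1 = (j s).1.1) ∧ ((NN n (fun r => (i r).1.2) L : ℕ) : ℤ) = A ∧
      z ∈ approxSq m n k i}
  have hsub : ball x r ⊆ (EE m n D k)ᶜ ∪ ⋃ A ∈ Finset.Icc (X - 1) (X + 1), F A := by
    intro z hz
    by_cases hzE : z ∈ EE m n D k
    · right
      obtain ⟨i, hi⟩ := EE_word m n hm hmn D hD j k z hzE
      have hz' := hz
      rw [mem_ball, Prod.dist_eq] at hz'
      have d1 := lt_of_le_of_lt (le_max_left _ _) hz'
      have d2 := lt_of_le_of_lt (le_max_right _ _) hz'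
      rw [Real.dist_eq, abs_lt] at d1 d2
      have hNN := NN_eq_of_strip m hm (fun r => (j r).1.1) (fun r => (i r).1.1) k z.2
        (hi k le_rfl).2 (by linarith) (by linarith)
      have hrows := NN_inj m (fun r => (i r).1.1) (fun r => (j r).1.1)
        (fun r => (hD _ (i r).2).1) (fun r => (hD _ (j r).2).1) k hNN
      have hc := (hi L (lk_le m n k hm hmn)).1
      rw [Set.mem_iUnion₂]
      refine ⟨((NN n (fun r => (i r).1.2) L : ℕ) : ℤ), ?_, hz, i, hrows, rfl,
        hc, (hi k le_rfl).2⟩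
      have hside := side_lower m n k hm hmn
      rw [← hL] at hside
      obtain ⟨c1, c2⟩ := hc
      unfold UU at c2
      rw [SS_eq n (by omega)] at c1 c2
      set A : ℕ := NN n (fun r => (i r).1.2) L
      rw [zpow_neg, zpow_natCast] at c1 c2
      rw [zpow_neg (n : ℝ), zpow_natCast] at hside
      have hnL : (0 : ℝ) < (n : ℝ) ^ L := by positivity
      have hinv : (n : ℝ) ^ L * ((n : ℝ) ^ L)⁻¹ = 1 := mul_inv_cancel₀ hnL.ne'
      have c1' : (A : ℝ) ≤ (n : ℝ) ^ L * z.1 := by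
        have := mul_le_mul_of_nonneg_left c1 hnL.le
        nlinarith
      have c2' : (n : ℝ) ^ L * z.1 ≤ A + 1 := by
        have := mul_le_mul_of_nonneg_left c2 hnL.le
        nlinarith
      have e1 : (n : ℝ) ^ L * z.1 < (n : ℝ) ^ L * x.1 + 1 := by
        have : z.1 < x.1 + ((n : ℝ) ^ L)⁻¹ := by linarith
        have := mul_lt_mul_of_pos_left this hnL
        nlinarith
      have e2 : (n : ℝ) ^ L * x.1 < (n : ℝ) ^ L * z.1 + 1 := by
        have : x.1 < z.1 + ((n : ℝ) ^ L)⁻¹ := by linarith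
        have := mul_lt_mul_of_pos_left this hnL
        nlinarith
      have f1 : (X : ℝ) ≤ (n : ℝ) ^ L * x.1 := Int.floor_le _
      have f2 : (n : ℝ) ^ L * x.1 < X + 1 := Int.lt_floor_add_one _
      rw [Finset.mem_Icc]
      have g1 : (((A : ℕ) : ℤ) : ℝ) < ((X + 2 : ℤ) : ℝ) := by push_cast; linarith
      have g2 : ((X - 2 : ℤ) : ℝ) < (((A : ℕ) : ℤ) : ℝ) := by push_cast; linarith
      have g1' := Int.cast_lt.1 g1
      have g2' := Int.cast_lt.1 g2
      omega
    · left; exact hzE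
  have hsum : μ (ball x r) ≤ ∑ A ∈ Finset.Icc (X - 1) (X + 1), μ (F A) := by
    calc _ ≤ _ := measure_mono hsub
      _ ≤ _ := measure_union_le _ _
      _ = μ (⋃ A ∈ Finset.Icc (X - 1) (X + 1), F A) := by
        rw [EE_null m n hm hmn D hD p hp hp1 μ hμ1 hμ k, zero_add]
      _ ≤ _ := measure_biUnion_finset_le _ _
  have hcard : (Finset.Icc (X - 1) (X + 1)).card = 3 := by
    rw [Int.card_Icc]; omega
  obtain ⟨A, hA, hmax⟩ := Finset.exists_max_image (Finset.Icc (X - 1) (X + 1)) (fun A => μ (F A))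
    ⟨X, by rw [Finset.mem_Icc]; omega⟩
  have h3 : μ (ball x r) ≤ 3 * μ (F A) := by
    refine hsum.trans ((Finset.sum_le_card_nsmul _ _ _ hmax).trans (le_of_eq ?_))
    rw [hcard, nsmul_eq_mul]; norm_num
  have hne : μ (F A) ≠ 0 := by
    intro h0
    rw [h0, mul_zero] at h3
    exact hpos (le_antisymm h3 bot_le)
  obtain ⟨z, hzb, i, hrows, hiA, hzi⟩ := nonempty_of_measure_ne_zero hne
  refine ⟨i, ⟨z, hzi, hzb⟩, hrows, h3.trans ?_⟩
  gcongr
  rintro z' ⟨-, i', hrows', hiA', hzi'⟩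
  have e1 : NN n (fun r => (i' r).1.2) L = NN n (fun r => (i r).1.2) L := by
    exact_mod_cast hiA'.trans hiA.symm
  have e2 : SS n (fun r => (i' r).1.2) L = SS n (fun r => (i r).1.2) L := by
    rw [SS_eq n (by omega), SS_eq n (by omega), e1]
  have e3 : SS m (fun r => (i' r).1.1) k = SS m (fun r => (i r).1.1) k := by
    unfold SS
    apply Finset.sum_congr rfl
    intro s hs
    simp only
    rw [hrows' s (Finset.mem_range.1 hs), hrows s (Finset.mem_range.1 hs)]
  rw [approxSq_eq] at hzi' ⊢
  unfold UU at hzi' ⊢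
  rw [← hL] at hzi' ⊢
  rw [← e2, ← e3]
  exact hzi'

lemma square_sub (m n : ℕ) (hm : 2 ≤ m) (hmn : m < n) {D : Finset (ℕ × ℕ)}
    (x : ℝ × ℝ) (k : ℕ) (i : Word D) (r : ℝ) (hrk : r ≤ (m : ℝ) ^ (-(k : ℤ)))
    (z : ℝ × ℝ) (hz : z ∈ approxSq m n k i) (hzb : z ∈ ball x r) :
    approxSq m n k i ⊆ ball x (3 * n * (m : ℝ) ^ (-(k : ℤ))) := by
  intro y hy
  have hn1 : (2 : ℝ) ≤ n := by exact_mod_cast (by omega)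
  have hm0 : (0 : ℝ) < m := by exact_mod_cast (by omega)
  have hM : (0 : ℝ) < (m : ℝ) ^ (-(k : ℤ)) := by positivity
  have hs := side_upper m n k hm hmn
  rw [approxSq_eq] at hz hy
  obtain ⟨⟨a1, a2⟩, ⟨a3, a4⟩⟩ := hz
  obtain ⟨⟨b1, b2⟩, ⟨b3, b4⟩⟩ := hy
  unfold UU at a2 a4 b2 b4
  rw [mem_ball] at hzb ⊢
  have hyz : dist y z ≤ n * (m : ℝ) ^ (-(k : ℤ)) := by
    rw [Prod.dist_eq]
    apply max_le
    · rw [Real.dist_eq, abs_le]; constructor <;> linarith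
    · rw [Real.dist_eq, abs_le]; constructor <;> nlinarith
  have := dist_triangle y z x
  nlinarith

theorem close_squares_in_Y_same_rows
    (m n : ℕ) (hm : 2 ≤ m) (hmn : m < n)
    (D : Finset (ℕ × ℕ)) (hD : ∀ d ∈ D, d.1 < m ∧ d.2 < n)
    (hrow : ∃ d ∈ D, ∃ d' ∈ D, d.1 ≠ d'.1)
    (hcol : ∃ d ∈ D, ∃ d' ∈ D, d.2 ≠ d'.2)
    (p : ℕ × ℕ → ℝ) (hp : ∀ d ∈ D, 0 < p d) (hp1 : ∑ d ∈ D, p d = 1)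
    (μ : Measure (ℝ × ℝ)) (hμ1 : IsProbabilityMeasure μ) (hμ : IsSelfAffine m n D p μ)
    (Λ : Set (ℝ × ℝ)) (hΛ : IsAttractor m n D Λ)
 :
    ∀ (α ε : ℝ), 0 < ε → ∀ x ∈ levelSet μ Λ α, ∀ j : Word D, proj m n j = x →
      ∃ K : ℕ, ∀ k ≥ K, Vk m j k ≤ ENNReal.ofReal (ε * k / 2) →
        ∃ i : Word D,
          infDist x (approxSq m n k i) ≤ D1 n * (m : ℝ) ^ (-(k : ℝ)) / 2 ∧
            MemY m n μ α ε k i ∧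
            ∀ r < k, ((i r).1.1 = (j r).1.1) := by
  intro α ε hε x hx j hj
  have hnull := far_null m n hm hmn D hD p hp hp1 μ hμ1 hμ
  have hpos : ∀ r > 0, μ (ball x r) ≠ 0 := fun r hr =>
    ball_pos m n hm hmn D p hp μ hμ1 hμ hnull Λ hΛ x hx.1 r hr
  have hα := alpha_pos m n hm hmn D hD hrow p hp hp1 μ hμ1 hμ x hpos α hx.2
  have hm2 : (2 : ℝ) ≤ m := by exact_mod_cast hm
  have hm0 : (0 : ℝ) < m := by linarith
  have hn2 : (2 : ℝ) ≤ n := by exact_mod_cast (by omega)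
  have hlm : 0 < Real.log m := Real.log_pos (by linarith)
  have lim1 := radius_limit m hm μ x α hx.2 (1 / m) (1 + ε / 2) (by positivity) (by positivity)
  have lim1' := lim1.sub (tendsto_const_div_atTop_nhds_zero_nat (Real.log 3))
  have lim2 := radius_limit m hm μ x α hx.2 (3 * n) 1 (by positivity) one_pos
  have ev1 := lim1'.eventually_const_lt (u := -(α * (1 + ε) * Real.log m)) (by
    have : 0 < α * ε * Real.log m := by positivity
    nlinarith)
  have ev2 := lim2.eventually_lt_const (u := -(α * (1 - ε) * Real.log m)) (by
    have : 0 < α * ε * Real.log m := by positivity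
    nlinarith)
  obtain ⟨K, hK⟩ := eventually_atTop.1 ((ev1.and ev2).and (eventually_gt_atTop 0))
  refine ⟨K, fun k hk hV => ?_⟩
  obtain ⟨⟨E1, E2⟩, hk0⟩ := hK k hk
  have hk0' : (0 : ℝ) < k := by exact_mod_cast hk0
  obtain ⟨l, hkl, hl, hlc⟩ := Vk_exists m j k (ε * k / 2) (by positivity) hV
  obtain ⟨s1, s2⟩ := strip_dist m n hm hD j k l hkl hl
  rw [hj] at s1 s2
  set r : ℝ := 1 / m * (m : ℝ) ^ (-((1 + ε / 2) * k)) with hr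
  have hr0 : 0 < r := by positivity
  have hr' : r = (m : ℝ) ^ (-((1 + ε / 2) * k + 1)) := by
    rw [hr, neg_add, Real.rpow_add hm0, Real.rpow_neg_one]
    ring
  have hrl : r ≤ (m : ℝ) ^ (-(l : ℤ)) := by
    rw [hr', ← Real.rpow_intCast]
    apply Real.rpow_le_rpow_of_exponent_le (by linarith)
    push_cast
    nlinarith
  have hzr : (m : ℝ) ^ (-(k : ℝ)) = (m : ℝ) ^ (-(k : ℤ)) := by
    rw [← Real.rpow_intCast]; push_cast; rfl
  have hMpos : (0 : ℝ) < (m : ℝ) ^ (-(k : ℤ)) := by positivity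
  have hrk2 : r ≤ (m : ℝ) ^ (-(k : ℤ)) / 2 := by
    have h1 : (m : ℝ) ^ (-((1 + ε / 2) * k)) ≤ (m : ℝ) ^ (-(k : ℤ)) := by
      rw [← hzr]
      apply Real.rpow_le_rpow_of_exponent_le (by linarith)
      nlinarith
    have h2 : (1 : ℝ) / m ≤ 1 / 2 := by gcongr
    calc r ≤ 1 / 2 * (m : ℝ) ^ (-(k : ℤ)) := by rw [hr]; gcongr
      _ = _ := by ring
  have hrk : r ≤ (m : ℝ) ^ (-(k : ℤ)) := by linarith
  obtain ⟨i, ⟨z, hzi, hzb⟩, hrows, hmass⟩ := exists_square m n hm hmn D hD p hp hp1 μ hμ1 hμ x j k r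
    hrk (by linarith) (by linarith) (hpos r hr0)
  refine ⟨i, ?_, ⟨?_, ?_⟩, hrows⟩
  · refine (infDist_le_dist_of_mem hzi).trans ?_
    rw [mem_ball, dist_comm] at hzb
    rw [hzr]
    have hD1 : 1 ≤ D1 n := by
      rw [D1, Real.one_le_sqrt]
      nlinarith
    nlinarith
  · have htp : 0 < (μ (ball x r)).toReal := ENNReal.toReal_pos (hpos r hr0) (measure_ne_top _ _)
    rw [← sub_div, lt_div_iff₀ hk0'] at E1
    have h1 : (m : ℝ) ^ (-((k : ℝ) * α * (1 + ε))) ≤ (μ (ball x r)).toReal / 3 := by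
      rw [Real.rpow_def_of_pos hm0, ← Real.le_log_iff_exp_le (by positivity),
        Real.log_div htp.ne' (by norm_num)]
      linarith
    have h2 : (μ (ball x r)).toReal / 3 ≤ (μ (approxSq m n k i)).toReal := by
      have := ENNReal.toReal_mono (by finiteness) hmass
      rw [ENNReal.toReal_mul] at this
      simp at this
      linarith
    exact ENNReal.ofReal_le_of_le_toReal (h1.trans h2)
  · have hsub := square_sub m n hm hmn x k i r hrk z hzi hzb
    have e : 3 * n * (m : ℝ) ^ (-(1 * (k : ℝ))) = 3 * n * (m : ℝ) ^ (-(k : ℤ)) := by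
      rw [one_mul, hzr]
    rw [e] at E2
    refine (measure_mono hsub).trans ?_
    have htp : 0 < (μ (ball x (3 * n * (m : ℝ) ^ (-(k : ℤ))))).toReal :=
      ENNReal.toReal_pos (hpos _ (by positivity)) (measure_ne_top _ _)
    rw [div_lt_iff₀ hk0'] at E2
    rw [← ENNReal.ofReal_toReal (measure_ne_top μ (ball x (3 * n * (m : ℝ) ^ (-(k : ℤ)))))]
    apply ENNReal.ofReal_le_ofReal
    rw [Real.rpow_def_of_pos hm0, ← Real.log_le_iff_le_exp htp]
    linarith

end BedfordMcMullen
end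

section
/- Fix t ∈ ℝ, α ∈ ℝ and ε > 0. There exists K ∈ ℕ such that for all k ≥ K and all 𝐢 ∈ Σ with R_k(𝐢) ∈ G(α,ε,k), one has μ(R_k(𝐢))^t ≤ (1+ε)^k Σ_{(d_1,…,d_k)∈Γ_k(𝐢)} (p_{d_1}⋯p_{d_k})^t (ω(d_1)⋯ω(d_k))^{1−σ}. -/
open MeasureTheory Metric Real Set Filter
open scoped ENNReal Topology

noncomputable section BedfordMcMullen

/-- Sets avoiding a measure-one set are null in the 1D self-similar situation. -/
lemma aux_outside (N : ℕ) (hN : 2 ≤ N) (D : Finset (ℕ × ℕ)) (c : ℕ × ℕ → ℕ)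
    (hc : ∀ d ∈ D, c d < N) (p : ℕ × ℕ → ℝ) (hp : ∀ d ∈ D, 0 < p d)
    (hp1 : ∑ d ∈ D, p d = 1) (ν : Measure ℝ) [IsProbabilityMeasure ν]
    (hν : ∀ A : Set ℝ, MeasurableSet A →
      ν.real A = ∑ d ∈ D, p d * ν.real {x | (x + c d) / N ∈ A}) :
    ν.real (Icc 0 1)ᶜ = 0 := by
  have hN2 : (2 : ℝ) ≤ N := by exact_mod_cast hN
  have hN0 : (0 : ℝ) < N := by linarith
  set E : ℝ → Set ℝ := fun R => (Icc (-R) (1 + R))ᶜ with hE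
  have hEm : ∀ R, MeasurableSet (E R) := fun R => measurableSet_Icc.compl
  have hEanti : Antitone E := by
    intro R R' h
    simp only [hE]
    apply compl_subset_compl.mpr
    apply Icc_subset_Icc <;> linarith
  have step : ∀ R, 0 < R → ν.real (E R) ≤ ν.real (E (2 * R)) := by
    intro R hR
    rw [hν _ (hEm R)]
    calc ∑ d ∈ D, p d * ν.real {x | (x + c d) / N ∈ E R}
        ≤ ∑ d ∈ D, p d * ν.real (E (2 * R)) := by
          apply Finset.sum_le_sum
          intro d hd
          apply mul_le_mul_of_nonneg_left _ (hp d hd).le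
          refine measureReal_mono ?_ (measure_ne_top _ _)
          intro x hx
          have hcd : (c d : ℝ) + 1 ≤ N := by exact_mod_cast hc d hd
          have hc0 : (0 : ℝ) ≤ c d := by positivity
          simp only [hE, mem_ofPred_eq, mem_compl_iff, mem_Icc] at hx ⊢
          intro h
          apply hx
          rw [le_div_iff₀ hN0, div_le_iff₀ hN0]
          constructor <;> nlinarith
      _ = ν.real (E (2 * R)) := by rw [← Finset.sum_mul, hp1, one_mul]
  have pos0 : ∀ R, 0 < R → ν.real (E R) = 0 := by
    intro R hR
    have h1 : ∀ j : ℕ, ν.real (E R) ≤ ν.real (E (2 ^ j * R)) := by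
      intro j
      induction j with
      | zero => simp
      | succ j ih =>
        refine ih.trans ((step _ (by positivity)).trans (le_of_eq ?_))
        congr 2; ring
    have hanti : Antitone (fun j : ℕ => E (2 ^ j * R)) := by
      intro a b hab
      apply hEanti
      exact mul_le_mul_of_nonneg_right (pow_le_pow_right₀ (by norm_num) hab) hR.le
    have hlim := tendsto_measure_iInter_atTop (μ := ν) (s := fun j : ℕ => E (2 ^ j * R))
      (fun j => (hEm _).nullMeasurableSet) hanti ⟨0, measure_ne_top _ _⟩
    have hempty : (⋂ j : ℕ, E (2 ^ j * R)) = ∅ := by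
      ext x
      simp only [mem_iInter, mem_empty_iff_false, iff_false, not_forall]
      obtain ⟨j, hj⟩ := pow_unbounded_of_one_lt (|x| / R) (one_lt_two (α := ℝ))
      refine ⟨j, ?_⟩
      simp only [hE, mem_compl_iff, not_not, mem_Icc]
      rw [div_lt_iff₀ hR] at hj
      have := neg_abs_le x
      have := le_abs_self x
      constructor <;> linarith
    rw [hempty, measure_empty] at hlim
    have hlim2 : Tendsto (fun j : ℕ => ν.real (E (2 ^ j * R))) atTop (𝓝 0) := by
      have := (ENNReal.tendsto_toReal ENNReal.zero_ne_top).comp hlim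
      simpa [Measure.real, Function.comp_def] using this
    exact le_antisymm (ge_of_tendsto' hlim2 h1) measureReal_nonneg
  have hun : (Icc (0 : ℝ) 1)ᶜ ⊆ ⋃ j : ℕ, E (1 / ((j : ℝ) + 1)) := by
    intro x hx
    simp only [mem_iUnion, hE, mem_compl_iff, mem_Icc, not_and_or, not_le] at hx ⊢
    rcases hx with hx | hx
    · obtain ⟨j, hj⟩ := exists_nat_one_div_lt (show 0 < -x by linarith)
      exact ⟨j, Or.inl (by linarith)⟩
    · obtain ⟨j, hj⟩ := exists_nat_one_div_lt (show 0 < x - 1 by linarith)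
      exact ⟨j, Or.inr (by linarith)⟩
  have hz : ν (⋃ j : ℕ, E (1 / ((j : ℝ) + 1))) = 0 := by
    rw [measure_iUnion_null_iff]
    intro j
    have := pos0 (1 / ((j : ℝ) + 1)) (by positivity)
    rwa [measureReal_eq_zero_iff] at this
  rw [measureReal_eq_zero_iff]
  exact measure_mono_null hun hz

lemma aux_atom (N : ℕ) (hN : 2 ≤ N) (D : Finset (ℕ × ℕ)) (c : ℕ × ℕ → ℕ)
    (hc : ∀ d ∈ D, c d < N) (hcc : ∃ d ∈ D, ∃ d' ∈ D, c d ≠ c d')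
    (p : ℕ × ℕ → ℝ) (hp : ∀ d ∈ D, 0 < p d)
    (hp1 : ∑ d ∈ D, p d = 1) (ν : Measure ℝ) [IsProbabilityMeasure ν]
    (hν : ∀ A : Set ℝ, MeasurableSet A →
      ν.real A = ∑ d ∈ D, p d * ν.real {x | (x + c d) / N ∈ A})
    (e : ℝ) (he : e = 0 ∨ e = 1) : ν.real {e} = 0 := by
  have hN2 : (2 : ℝ) ≤ N := by exact_mod_cast hN
  have hN0 : (0 : ℝ) < N := by linarith
  have hout := aux_outside N hN D c hc p hp hp1 ν hν
  have hset : ∀ d, {x : ℝ | (x + c d) / N ∈ ({e} : Set ℝ)} = {N * e - c d} := by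
    intro d
    ext x
    simp only [mem_ofPred_eq, mem_singleton_iff]
    rw [div_eq_iff hN0.ne']
    constructor <;> intro h <;> linarith
  have hoff : ∀ d ∈ D, (N * e - c d : ℝ) ≠ e → ν.real {(N * e - c d : ℝ)} = 0 := by
    intro d hd hne
    apply le_antisymm _ measureReal_nonneg
    rw [← hout]
    refine measureReal_mono ?_ (measure_ne_top _ _)
    rw [singleton_subset_iff, mem_compl_iff, mem_Icc]
    rintro ⟨h1, h2⟩
    have hcd : (c d : ℝ) + 1 ≤ N := by exact_mod_cast hc d hd
    have hc0 : (0 : ℝ) ≤ c d := by positivity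
    apply hne
    rcases he with rfl | rfl <;> linarith
  obtain ⟨d0, hd0, hne⟩ : ∃ d ∈ D, (N * e - c d : ℝ) ≠ e := by
    by_contra! hcon
    obtain ⟨d, hd, d', hd', hdd⟩ := hcc
    apply hdd
    have h1 := hcon d hd
    have h2 := hcon d' hd'
    have : (c d : ℝ) = c d' := by linarith
    exact_mod_cast this
  have hle : ν.real {e} ≤ ∑ d ∈ D.erase d0, p d * ν.real {e} := by
    conv_lhs => rw [hν _ (measurableSet_singleton e)]
    rw [← Finset.add_sum_erase D _ hd0, hset, hoff d0 hd0 hne, mul_zero, zero_add]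
    apply Finset.sum_le_sum
    intro d hd
    have hd' := Finset.mem_of_mem_erase hd
    apply mul_le_mul_of_nonneg_left _ (hp d hd').le
    rw [hset]
    by_cases h : (N * e - c d : ℝ) = e
    · rw [h]
    · rw [hoff d hd' h]; exact measureReal_nonneg
  rw [← Finset.sum_mul] at hle
  have hs := Finset.add_sum_erase D p hd0
  have h0 := hp d0 hd0
  have hnn : 0 ≤ ν.real {e} := measureReal_nonneg
  nlinarith

lemma aux_open (N : ℕ) (hN : 2 ≤ N) (D : Finset (ℕ × ℕ)) (c : ℕ × ℕ → ℕ)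
    (hc : ∀ d ∈ D, c d < N) (hcc : ∃ d ∈ D, ∃ d' ∈ D, c d ≠ c d')
    (p : ℕ × ℕ → ℝ) (hp : ∀ d ∈ D, 0 < p d)
    (hp1 : ∑ d ∈ D, p d = 1) (ν : Measure ℝ) [IsProbabilityMeasure ν]
    (hν : ∀ A : Set ℝ, MeasurableSet A →
      ν.real A = ∑ d ∈ D, p d * ν.real {x | (x + c d) / N ∈ A}) :
    ∀ᵐ x ∂ν, x ∈ Ioo (0 : ℝ) 1 := by
  have h1 := aux_outside N hN D c hc p hp hp1 ν hν
  have h2 := aux_atom N hN D c hc hcc p hp hp1 ν hν 0 (Or.inl rfl)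
  have h3 := aux_atom N hN D c hc hcc p hp hp1 ν hν 1 (Or.inr rfl)
  rw [measureReal_eq_zero_iff] at h1 h2 h3
  have h1' : ∀ᵐ x ∂ν, x ∈ Icc (0 : ℝ) 1 := h1
  have h2' : ∀ᵐ x ∂ν, x ≠ 0 := by
    rw [ae_iff]; simpa using h2
  have h3' : ∀ᵐ x ∂ν, x ≠ 1 := by
    rw [ae_iff]; simpa using h3
  filter_upwards [h1', h2', h3'] with x a b c
  exact ⟨lt_of_le_of_ne a.1 (Ne.symm b), lt_of_le_of_ne a.2 c⟩

/-- 1D coding interval. -/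
def cInt (N l : ℕ) (a : ℕ → ℕ) : Set ℝ :=
  Icc (∑ r ∈ Finset.range l, (a r : ℝ) * (N : ℝ) ^ (-(r + 1 : ℤ)))
    (∑ r ∈ Finset.range l, (a r : ℝ) * (N : ℝ) ^ (-(r + 1 : ℤ)) + (N : ℝ) ^ (-(l : ℤ)))

lemma cInt_zero (N : ℕ) (a : ℕ → ℕ) : cInt N 0 a = Icc 0 1 := by simp [cInt]

lemma cInt_step (N : ℕ) (hN : 2 ≤ N) (l : ℕ) (a : ℕ → ℕ) (x : ℝ) (c : ℕ) :
    (x + c) / N ∈ cInt N (l + 1) a ↔ x + c - a 0 ∈ cInt N l (fun r => a (r + 1)) := by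
  have hN2 : (2 : ℝ) ≤ N := by exact_mod_cast hN
  have hN0 : (0 : ℝ) < N := by linarith
  have hs : ∑ r ∈ Finset.range (l + 1), (a r : ℝ) * (N : ℝ) ^ (-(r + 1 : ℤ)) =
      (∑ r ∈ Finset.range l, (a (r + 1) : ℝ) * (N : ℝ) ^ (-(r + 1 : ℤ)) + a 0) / N := by
    rw [Finset.sum_range_succ', add_div, Finset.sum_div]
    congr 1
    · apply Finset.sum_congr rfl
      intro r _
      rw [mul_div_assoc]
      congr 1
      push_cast
      rw [neg_add _ (1 : ℤ), zpow_add₀ hN0.ne', zpow_neg_one]; rfl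
    · simp [div_eq_mul_inv]
  have he : (N : ℝ) ^ (-((l + 1 : ℕ) : ℤ)) = (N : ℝ) ^ (-(l : ℤ)) / N := by
    push_cast
    rw [neg_add _ (1 : ℤ), zpow_add₀ hN0.ne', zpow_neg_one]; rfl
  simp only [cInt, mem_Icc]
  rw [hs, he, ← add_div, div_le_div_iff_of_pos_right hN0, div_le_div_iff_of_pos_right hN0]
  constructor <;> rintro ⟨h1, h2⟩ <;> constructor <;> linarith

lemma cInt_subset (N : ℕ) (hN : 2 ≤ N) (l : ℕ) (a : ℕ → ℕ) (ha : ∀ r, a r < N) :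
    cInt N l a ⊆ Icc 0 1 := by
  have hN2 : (2 : ℝ) ≤ N := by exact_mod_cast hN
  have hN0 : (0 : ℝ) < N := by linarith
  induction l generalizing a with
  | zero => rw [cInt_zero]
  | succ l ih =>
    intro y hy
    have h := (cInt_step N hN l a (N * y) 0).1 (by
      have : ((N : ℝ) * y + (0 : ℕ)) / N = y := by simp; field_simp
      rwa [this])
    have h' := ih (fun r => a (r + 1)) (fun r => ha _) h
    have hcd : (a 0 : ℝ) + 1 ≤ N := by exact_mod_cast ha 0
    have hc0 : (0 : ℝ) ≤ a 0 := by positivity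
    simp only [Nat.cast_zero, add_zero, mem_Icc] at h' ⊢
    constructor <;> nlinarith

lemma cInt_mem (N : ℕ) (hN : 2 ≤ N) (l : ℕ) (a : ℕ → ℕ) (ha : ∀ r, a r < N) (x : ℝ)
    (hx : x ∈ Ioo (0 : ℝ) 1) (c : ℕ) :
    (x + c) / N ∈ cInt N (l + 1) a ↔ c = a 0 ∧ x ∈ cInt N l (fun r => a (r + 1)) := by
  rw [cInt_step N hN]
  constructor
  · intro h
    have h' := cInt_subset N hN l (fun r => a (r + 1)) (fun r => ha _) h
    have h1 : c = a 0 := by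
      have e1 : (c : ℝ) < a 0 + 1 := by linarith [h'.2, hx.1]
      have e2 : (a 0 : ℝ) < c + 1 := by linarith [h'.1, hx.2]
      have e1' : c < a 0 + 1 := by exact_mod_cast e1
      have e2' : a 0 < c + 1 := by exact_mod_cast e2
      omega
    refine ⟨h1, ?_⟩
    rw [h1] at h
    simpa using h
  · rintro ⟨rfl, h⟩
    simpa using h

/-- The measure of (generalised) approximate squares. -/
lemma measure_sq (m n : ℕ) (hm : 2 ≤ m) (hmn : m < n)
    (D : Finset (ℕ × ℕ)) (hD : ∀ d ∈ D, d.1 < m ∧ d.2 < n)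
    (hrow : ∃ d ∈ D, ∃ d' ∈ D, d.1 ≠ d'.1)
    (hcol : ∃ d ∈ D, ∃ d' ∈ D, d.2 ≠ d'.2)
    (p : ℕ × ℕ → ℝ) (hp : ∀ d ∈ D, 0 < p d) (hp1 : ∑ d ∈ D, p d = 1)
    (μ : Measure (ℝ × ℝ)) (hμ1 : IsProbabilityMeasure μ) (hμ : IsSelfAffine m n D p μ)
    (k l : ℕ) (hlk : l ≤ k) (i : ℕ → ℕ × ℕ) (hi : ∀ r, i r ∈ D) :
    μ.real (cInt n l (fun r => (i r).2) ×ˢ cInt m k (fun r => (i r).1)) =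
      ∏ r ∈ Finset.range k, if r < l then p (i r) else qrow D p (i r).1 := by
  have hn : 2 ≤ n := by omega
  have hn0 : (n : ℝ) ≠ 0 := by positivity
  have hm0 : (m : ℝ) ≠ 0 := by positivity
  have hr : ∀ A : Set (ℝ × ℝ), MeasurableSet A →
      μ.real A = ∑ d ∈ D, p d * μ.real (Tmap m n d ⁻¹' A) := by
    intro A hA
    rw [Measure.real, hμ A hA, ENNReal.toReal_sum]
    · apply Finset.sum_congr rfl
      intro d hd
      rw [ENNReal.toReal_mul, ENNReal.toReal_ofReal (hp d hd).le, Measure.real]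
    · intro d _
      exact ENNReal.mul_ne_top ENNReal.ofReal_ne_top (measure_ne_top _ _)
  have hae1 : ∀ᵐ z ∂μ, z.1 ∈ Ioo (0 : ℝ) 1 := by
    have : IsProbabilityMeasure (μ.map Prod.fst) :=
      Measure.isProbabilityMeasure_map measurable_fst.aemeasurable
    have := aux_open n hn D (fun d => d.2) (fun d hd => (hD d hd).2) hcol p hp hp1
      (μ.map Prod.fst) (by
        intro A hA
        rw [map_measureReal_apply measurable_fst hA, hr _ (measurable_fst hA)]
        apply Finset.sum_congr rfl
        intro d _
        rw [map_measureReal_apply measurable_fst]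
        · rfl
        · exact (by fun_prop : Measurable fun x : ℝ => (x + (d.2 : ℝ)) / n) hA)
    exact ae_of_ae_map measurable_fst.aemeasurable this
  have hae2 : ∀ᵐ z ∂μ, z.2 ∈ Ioo (0 : ℝ) 1 := by
    have : IsProbabilityMeasure (μ.map Prod.snd) :=
      Measure.isProbabilityMeasure_map measurable_snd.aemeasurable
    have := aux_open m hm D (fun d => d.1) (fun d hd => (hD d hd).1) hrow p hp hp1
      (μ.map Prod.snd) (by
        intro A hA
        rw [map_measureReal_apply measurable_snd hA, hr _ (measurable_snd hA)]
        apply Finset.sum_congr rfl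
        intro d _
        rw [map_measureReal_apply measurable_snd]
        · rfl
        · exact (by fun_prop : Measurable fun x : ℝ => (x + (d.1 : ℝ)) / m) hA)
    exact ae_of_ae_map measurable_snd.aemeasurable this
  have hms : ∀ (l k : ℕ) (a b : ℕ → ℕ), MeasurableSet (cInt n l a ×ˢ cInt m k b) :=
    fun l k a b => measurableSet_Icc.prod measurableSet_Icc
  induction k generalizing l i with
  | zero =>
    obtain rfl : l = 0 := by omega
    rw [cInt_zero, cInt_zero, Finset.prod_range_zero]
    rw [measureReal_congr (t := univ), probReal_univ]
    filter_upwards [hae1, hae2] with z h1 h2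
    apply propext
    exact ⟨fun _ => trivial, fun _ => ⟨Ioo_subset_Icc_self h1, Ioo_subset_Icc_self h2⟩⟩
  | succ k ih =>
    rw [hr _ (hms _ _ _ _), Finset.prod_range_succ']
    cases l with
    | zero =>
      have hT : ∀ d ∈ D, μ.real (Tmap m n d ⁻¹'
          (cInt n 0 (fun r => (i r).2) ×ˢ cInt m (k + 1) (fun r => (i r).1))) =
          if d.1 = (i 0).1 then
            μ.real (cInt n 0 (fun r => (i (r + 1)).2) ×ˢ cInt m k (fun r => (i (r + 1)).1))
          else 0 := by
        intro d hd
        have key : ∀ᵐ z ∂μ, (Tmap m n d z ∈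
            (cInt n 0 (fun r => (i r).2) ×ˢ cInt m (k + 1) (fun r => (i r).1)) ↔
            d.1 = (i 0).1 ∧ z ∈
              (cInt n 0 (fun r => (i (r + 1)).2) ×ˢ cInt m k (fun r => (i (r + 1)).1))) := by
          filter_upwards [hae1, hae2] with z h1 h2
          have e := cInt_mem m hm k (fun r => (i r).1) (fun r => (hD _ (hi r)).1) z.2 h2 d.1
          have hx : (z.1 + d.2) / n ∈ Icc (0 : ℝ) 1 := by
            have hcd : (d.2 : ℝ) + 1 ≤ n := by exact_mod_cast (hD d hd).2
            constructor
            · have := h1.1; positivity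
            · rw [div_le_one (by positivity)]; linarith [h1.2]
          simp only [Tmap, mem_prod, cInt_zero, hx, true_and, Ioo_subset_Icc_self h1]
          exact e
        split_ifs with h
        · apply measureReal_congr
          filter_upwards [key] with z hz
          apply propext
          exact hz.trans (and_iff_right h)
        · rw [measureReal_congr (t := ∅), measureReal_empty]
          filter_upwards [key] with z hz
          apply propext
          exact hz.trans (by simp only [h, false_and]; rfl)
      rw [Finset.sum_congr rfl (fun d hd => by rw [hT d hd])]
      rw [ih 0 (by omega) (fun r => i (r + 1)) (fun r => hi _)]
      simp only [mul_ite, mul_zero, not_lt_zero, if_false]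
      rw [← Finset.sum_filter, ← Finset.sum_mul, mul_comm]
      rfl
    | succ l =>
      have hT : ∀ d ∈ D, μ.real (Tmap m n d ⁻¹'
          (cInt n (l + 1) (fun r => (i r).2) ×ˢ cInt m (k + 1) (fun r => (i r).1))) =
          if d = i 0 then
            μ.real (cInt n l (fun r => (i (r + 1)).2) ×ˢ cInt m k (fun r => (i (r + 1)).1))
          else 0 := by
        intro d hd
        have key : ∀ᵐ z ∂μ, (Tmap m n d z ∈
            (cInt n (l + 1) (fun r => (i r).2) ×ˢ cInt m (k + 1) (fun r => (i r).1)) ↔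
            d = i 0 ∧ z ∈
              (cInt n l (fun r => (i (r + 1)).2) ×ˢ cInt m k (fun r => (i (r + 1)).1))) := by
          filter_upwards [hae1, hae2] with z h1 h2
          have e := cInt_mem m hm k (fun r => (i r).1) (fun r => (hD _ (hi r)).1) z.2 h2 d.1
          have e' := cInt_mem n hn l (fun r => (i r).2) (fun r => (hD _ (hi r)).2) z.1 h1 d.2
          simp only [Tmap, mem_prod]
          rw [e, e', Prod.ext_iff]
          tauto
        split_ifs with h
        · apply measureReal_congr
          filter_upwards [key] with z hz
          apply propext
          exact hz.trans (and_iff_right h)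
        · rw [measureReal_congr (t := ∅), measureReal_empty]
          filter_upwards [key] with z hz
          apply propext
          exact hz.trans (by simp only [h, false_and]; rfl)
      rw [Finset.sum_congr rfl (fun d hd => by rw [hT d hd])]
      rw [ih l (by omega) (fun r => i (r + 1)) (fun r => hi _)]
      simp only [mul_ite, mul_zero, Finset.sum_ite_eq', hi, if_true, Nat.zero_lt_succ,
        Nat.add_lt_add_iff_right]
      rw [mul_comm]

lemma gamma_sum (m n : ℕ) (D : Finset (ℕ × ℕ)) (p : ℕ × ℕ → ℝ) (hp : ∀ d ∈ D, 0 < p d)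
    (t s : ℝ) (homg : ∀ d ∈ D, 0 < omg D p t d) (k : ℕ) (i : Word D) :
    ∑ w ∈ GammaSet m n k i,
      (∏ r : Fin k, p (w r).1) ^ t * (∏ r : Fin k, omg D p t (w r).1) ^ s =
    ∏ r ∈ Finset.range k,
      ((if r < lk m n k then p (i r).1 ^ t else gam D p t (i r).1.1) *
        omg D p t (i r).1 ^ s) := by
  classical
  have hG : GammaSet m n k i = Fintype.piFinset (fun r : Fin k =>
      if (r : ℕ) < lk m n k then ({i r} : Finset (Digit D)) else
        Finset.univ.filter fun d => d.1.1 = (i r).1.1) := by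
    ext w
    simp only [GammaSet, Finset.mem_filter, Finset.mem_univ, true_and, Fintype.mem_piFinset]
    constructor
    · rintro ⟨h1, h2⟩ r
      split_ifs with h
      · simpa using h1 r h
      · simpa using h2 r (not_lt.1 h)
    · intro h
      refine ⟨fun r hr => ?_, fun r hr => ?_⟩
      · have := h r
        rw [if_pos hr] at this
        simpa using this
      · have := h r
        rw [if_neg (not_lt.2 hr)] at this
        simpa using this
  have hterm : ∀ w : Fin k → Digit D,
      (∏ r : Fin k, p (w r).1) ^ t * (∏ r : Fin k, omg D p t (w r).1) ^ s =
      ∏ r : Fin k, (p (w r).1 ^ t * omg D p t (w r).1 ^ s) := by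
    intro w
    rw [Finset.prod_mul_distrib, Real.finsetProd_rpow _ _ (fun r _ => (hp _ (w r).2).le),
      Real.finsetProd_rpow _ _ (fun r _ => (homg _ (w r).2).le)]
  rw [Finset.sum_congr rfl (fun w _ => hterm w), hG,
    ← Finset.prod_univ_sum _ (fun _ (d : Digit D) => p d.1 ^ t * omg D p t d.1 ^ s),
    ← Fin.prod_univ_eq_prod_range (fun r => (if r < lk m n k then p (i r).1 ^ t
      else gam D p t (i r).1.1) * omg D p t (i r).1 ^ s)]
  apply Finset.prod_congr rfl
  intro r _
  split_ifs with h
  · simp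
  · rw [gam, Finset.sum_mul]
    have e : ∀ d ∈ Finset.univ.filter (fun d : Digit D => d.1.1 = (i r).1.1),
        p d.1 ^ t * omg D p t d.1 ^ s = p d.1 ^ t * omg D p t (i r).1 ^ s := by
      intro d hd
      simp only [Finset.mem_filter, Finset.mem_univ, true_and] at hd
      simp only [omg, hd]
    rw [Finset.sum_congr rfl e]
    rw [Finset.sum_filter, Finset.sum_filter]
    exact Finset.sum_coe_sort D
      (fun d => if d.1 = (i r).1.1 then p d ^ t * omg D p t (i r).1 ^ s else 0)

theorem measure_power_bound_on_G
    (m n : ℕ) (hm : 2 ≤ m) (hmn : m < n)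
    (D : Finset (ℕ × ℕ)) (hD : ∀ d ∈ D, d.1 < m ∧ d.2 < n)
    (hrow : ∃ d ∈ D, ∃ d' ∈ D, d.1 ≠ d'.1)
    (hcol : ∃ d ∈ D, ∃ d' ∈ D, d.2 ≠ d'.2)
    (p : ℕ × ℕ → ℝ) (hp : ∀ d ∈ D, 0 < p d) (hp1 : ∑ d ∈ D, p d = 1)
    (μ : Measure (ℝ × ℝ)) (hμ1 : IsProbabilityMeasure μ) (hμ : IsSelfAffine m n D p μ)
    (Λ : Set (ℝ × ℝ)) (hΛ : IsAttractor m n D Λ)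

    (t α ε : ℝ) (hε : 0 < ε) :
    ∃ K : ℕ, ∀ k ≥ K, ∀ i : Word D, MemG m n μ p t α ε k i →
      (μ (approxSq m n k i)).toReal ^ t ≤
        (1 + ε) ^ k * ∑ w ∈ GammaSet m n k i,
          (∏ r : Fin k, p (w r).1) ^ t * (∏ r : Fin k, omg D p t (w r).1) ^ (1 - sig m n) := by
  have hn : 2 ≤ n := by omega
  have hlm : 0 < Real.log m := Real.log_pos (by exact_mod_cast hm)
  have hln : 0 < Real.log n := Real.log_pos (by exact_mod_cast hn)
  have hs0 : 0 < sig m n := div_pos hlm hln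
  have hs1 : sig m n < 1 := by
    rw [sig, div_lt_one hln]
    exact Real.log_lt_log (by positivity) (by exact_mod_cast hmn)
  set s := sig m n with hsdef
  have hq : ∀ d ∈ D, 0 < qrow D p d.1 := fun d hd =>
    Finset.sum_pos (fun e he => hp e (Finset.mem_filter.1 he).1)
      ⟨d, Finset.mem_filter.2 ⟨hd, rfl⟩⟩
  have hg : ∀ d ∈ D, 0 < gam D p t d.1 := fun d hd =>
    Finset.sum_pos (fun e he => Real.rpow_pos_of_pos (hp e (Finset.mem_filter.1 he).1) _)
      ⟨d, Finset.mem_filter.2 ⟨hd, rfl⟩⟩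
  have homg : ∀ d ∈ D, 0 < omg D p t d := fun d hd =>
    mul_pos (Real.rpow_pos_of_pos (hq d hd) _) (inv_pos.2 (hg d hd))
  have hL : 0 < Real.log (1 + ε) := Real.log_pos (by linarith)
  set L := Real.log (1 + ε) with hLdef
  set C := ∑ d ∈ D, |Real.log (omg D p t d)| with hC
  have hC0 : 0 ≤ C := Finset.sum_nonneg fun _ _ => abs_nonneg _
  have hCd : ∀ d ∈ D, |Real.log (omg D p t d)| ≤ C := fun d hd =>
    Finset.single_le_sum (f := fun d => |Real.log (omg D p t d)|)
      (fun _ _ => abs_nonneg _) hd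
  obtain ⟨K1, hK1⟩ := exists_nat_gt (1 / s)
  obtain ⟨K2, hK2⟩ := exists_nat_gt (C / ((1 - s) * L))
  refine ⟨max K1 K2 + 1, fun k hk i hG => ?_⟩
  have hkK1 : (K1 : ℝ) ≤ k := by exact_mod_cast (by omega : K1 ≤ k)
  have hkK2 : (K2 : ℝ) ≤ k := by exact_mod_cast (by omega : K2 ≤ k)
  have hk0 : (0 : ℝ) < k := by exact_mod_cast (by omega : 0 < k)
  have hCk : C ≤ (1 - s) * L * k := by
    have h1 : 0 < (1 - s) * L := mul_pos (by linarith) hL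
    have := hK2.le.trans hkK2
    rw [div_le_iff₀ h1] at this
    linarith
  have hsk : 1 ≤ s * k := by
    have := hK1.le.trans hkK1
    rw [div_le_iff₀ hs0] at this
    linarith
  have hl_le : (lk m n k : ℝ) ≤ s * k := Nat.floor_le (by positivity)
  have hl_gt : s * k < (lk m n k : ℝ) + 1 := Nat.lt_floor_add_one _
  have hl1 : 1 ≤ lk m n k := Nat.le_floor (by exact_mod_cast hsk)
  have hlk : lk m n k ≤ k := by
    have : (lk m n k : ℝ) ≤ k := by nlinarith
    exact_mod_cast this
  set l := lk m n k with hldef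
  have hl0 : (0 : ℝ) < l := by exact_mod_cast hl1
  have hmeas : (μ (approxSq m n k i)).toReal =
      ∏ r ∈ Finset.range k, if r < l then p (i r).1 else qrow D p (i r).1.1 :=
    measure_sq m n hm hmn D hD hrow hcol p hp hp1 μ hμ1 hμ k l hlk
      (fun r => (i r).1) (fun r => (i r).2)
  rw [gamma_sum m n D p hp t (1 - s) homg k i, hmeas, ← Real.finsetProd_rpow _ _ (by
    intro r _
    split_ifs
    · exact (hp _ (i r).2).le
    · exact (hq _ (i r).2).le)]
  have hfac : ∀ r ∈ Finset.range k,
      (if r < l then p (i r).1 else qrow D p (i r).1.1) ^ t =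
      (if r < l then p (i r).1 ^ t else gam D p t (i r).1.1) *
        (if r < l then 1 else omg D p t (i r).1) := by
    intro r _
    split_ifs
    · simp
    · rw [omg]
      have := (hg _ (i r).2).ne'
      field_simp
  rw [Finset.prod_congr rfl hfac, Finset.prod_mul_distrib, Finset.prod_mul_distrib,
    mul_left_comm]
  apply mul_le_mul_of_nonneg_left _ (Finset.prod_nonneg fun r _ => by
    split_ifs
    · exact (Real.rpow_pos_of_pos (hp _ (i r).2) _).le
    · exact (hg _ (i r).2).le)
  set S : ℕ → ℝ := fun j => ∑ r ∈ Finset.range j, Real.log (omg D p t (i r).1) with hS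
  have hprod1 : ∏ r ∈ Finset.range k, (if r < l then 1 else omg D p t (i r).1) =
      Real.exp (S k - S l) := by
    rw [← Finset.prod_range_mul_prod_Ico _ hlk, hS]
    simp only
    rw [← Finset.sum_Ico_eq_sub _ hlk, Real.exp_sum, Finset.prod_eq_one, one_mul]
    · apply Finset.prod_congr rfl
      intro r hr
      rw [if_neg (not_lt.2 (Finset.mem_Ico.1 hr).1), Real.exp_log (homg _ (i r).2)]
    · intro r hr
      rw [if_pos (Finset.mem_range.1 hr)]
  have hprod2 : ∏ r ∈ Finset.range k, omg D p t (i r).1 ^ (1 - s) =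
      Real.exp (S k * (1 - s)) := by
    rw [hS]
    simp only
    rw [Finset.sum_mul, Real.exp_sum]
    apply Finset.prod_congr rfl
    intro r _
    rw [Real.rpow_def_of_pos (homg _ (i r).2)]
  have hprod3 : (1 + ε) ^ k = Real.exp (k * L) := by
    rw [Real.exp_nat_mul, hLdef, Real.exp_log (by linarith)]
  rw [hprod1, hprod2, hprod3, ← Real.exp_add, Real.exp_le_exp]
  have hA : -L ≤ 1 / (l : ℝ) * S l - 1 / (k : ℝ) * S k := hG.2
  have hSk : |S k| ≤ k * C := by
    calc |S k| ≤ ∑ r ∈ Finset.range k, |Real.log (omg D p t (i r).1)| :=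
          Finset.abs_sum_le_sum_abs _ _
      _ ≤ ∑ r ∈ Finset.range k, C := Finset.sum_le_sum fun r _ => hCd _ (i r).2
      _ = k * C := by simp
  have hb : |S k / k| ≤ C := by
    rw [abs_div, abs_of_pos hk0, div_le_iff₀ hk0]; linarith
  obtain ⟨b, hbdef⟩ : ∃ b, b = S k / k := ⟨_, rfl⟩
  rw [← hbdef] at hb
  have hSb : S k = k * b := by rw [hbdef]; field_simp
  have hA2 : l * b - l * L ≤ S l := by
    have h1 : (l : ℝ) * (-L) ≤ l * (1 / (l : ℝ) * S l - 1 / (k : ℝ) * S k) :=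
      mul_le_mul_of_nonneg_left hA hl0.le
    have h2 : (l : ℝ) * (1 / (l : ℝ) * S l - 1 / (k : ℝ) * S k) = S l - l * b := by
      rw [hbdef]; field_simp
    linarith
  have hx : (s * k - l) * b ≤ C := by
    have h1 := le_abs_self b
    have h2 : (s * k - l) * b ≤ (s * k - l) * C :=
      mul_le_mul_of_nonneg_left (h1.trans hb) (by linarith)
    have h3 : (s * k - l) * C ≤ 1 * C := mul_le_mul_of_nonneg_right (by linarith) hC0
    linarith
  have hy : l * L ≤ s * k * L := mul_le_mul_of_nonneg_right hl_le hL.le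
  rw [hSb]
  linarith

end BedfordMcMullen
end
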